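/- arXiv:2105.05084 — 4 statements merged into one kernel-verified Lean document; each statement's English description precedes it below -/
import Mathlib

section
/- (Strong local nondeterminism in the time variable.) Fix x₀ ∈ ℝ^N. For every a > 0 there exist constants C > 0 and r₀ > 0 such that for every integer n ≥ 1, all t, t¹, …, tⁿ ∈ [a, ∞) with max_{1≤j≤n}|t − t^j| ≤ r₀, and all real numbers a₁, …, aₙ, one has ∫_ℝ ∫_{ℝ^N} |𝒢_{t,x₀}(τ, ξ) − Σ_{j=1}^n a_j 𝒢_{t^j,x₀}(τ, ξ)|² |τ|^{1−2H} h_β(ξ) dξ dτ ≥ C min_{1≤j≤n} |t − t^j|^{2α}. (Equivalently, Var(u₁(t, x₀) | u₁(t¹, x₀), …, u₁(tⁿ, x₀)) ≥ C min_j |t − t^j|^{2α}.) -/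
open MeasureTheory Set
open scoped ENNReal

/-- The time–space Fourier transform `𝒢_{t,x}(τ, ξ)` of the wave kernel
`g_{t,x}(s, y) = G(t − s, x − y) 1_{[0,t]}(s)`. -/
noncomputable def Gker (N : ℕ) (t : ℝ) (x : EuclideanSpace ℝ (Fin N)) (τ : ℝ)
    (ξ : EuclideanSpace ℝ (Fin N)) : ℂ :=
  (Complex.exp (-Complex.I * ((inner ℝ x ξ : ℝ) : ℂ)) / (2 * (‖ξ‖ : ℂ))) *
    ((Complex.exp (-Complex.I * (t : ℂ) * (τ : ℂ)) -
        Complex.exp (Complex.I * (t : ℂ) * (‖ξ‖ : ℂ))) / ((τ : ℂ) + (‖ξ‖ : ℂ)) -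
      (Complex.exp (-Complex.I * (t : ℂ) * (τ : ℂ)) -
        Complex.exp (-Complex.I * (t : ℂ) * (‖ξ‖ : ℂ))) / ((τ : ℂ) - (‖ξ‖ : ℂ)))

/-- The spectral integral `∫_ℝ ∫_{ℝ^N} |f(τ,ξ)|² |τ|^{1−2H} h_β(ξ) dξ dτ`, which (up to a
positive constant) gives the variance of the corresponding linear functional of the solution. -/
noncomputable def specInt (N : ℕ) (H : ℝ) (hfun : EuclideanSpace ℝ (Fin N) → ℝ)
    (f : ℝ → EuclideanSpace ℝ (Fin N) → ℂ) : ℝ≥0∞ :=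
  ∫⁻ τ : ℝ, ∫⁻ ξ : EuclideanSpace ℝ (Fin N),
    ENNReal.ofReal (‖f τ ξ‖ ^ 2 * |τ| ^ (1 - 2 * H) * hfun ξ)


section
open scoped FourierTransform

lemma snd_cs {α : Type*} [MeasurableSpace α] (μ : Measure α) (f g : α → ℂ) (w : α → ℝ)
    (hf : Measurable f) (hg : Measurable g) (hw : Measurable w) (hpos : ∀ᵐ x ∂μ, 0 < w x) :
    (∫⁻ x, ‖f x * g x‖ₑ ∂μ) ^ 2 ≤ (∫⁻ x, ENNReal.ofReal (‖f x‖ ^ 2 * w x) ∂μ) *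
      ∫⁻ x, ENNReal.ofReal (‖g x‖ ^ 2 * (w x)⁻¹) ∂μ := by
  have h1 : ∫⁻ x, ‖f x * g x‖ₑ ∂μ = ∫⁻ x, ((fun x => ENNReal.ofReal (‖f x‖ * √(w x))) *
      (fun x => ENNReal.ofReal (‖g x‖ * √((w x)⁻¹)))) x ∂μ := by
    apply lintegral_congr_ae
    filter_upwards [hpos] with x hx
    simp only [Pi.mul_apply]
    rw [← ENNReal.ofReal_mul (by positivity), ← ofReal_norm, norm_mul]
    congr 1
    rw [Real.sqrt_inv]
    have : √(w x) ≠ 0 := by positivity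
    field_simp
  have h2 := ENNReal.lintegral_mul_le_Lp_mul_Lq μ Real.HolderConjugate.two_two
    (f := fun x => ENNReal.ofReal (‖f x‖ * √(w x)))
    (g := fun x => ENNReal.ofReal (‖g x‖ * √((w x)⁻¹))) (by fun_prop) (by fun_prop)
  rw [h1]
  refine (pow_le_pow_left' h2 2).trans ?_
  rw [mul_pow, ← ENNReal.rpow_natCast, ← ENNReal.rpow_natCast, ← ENNReal.rpow_mul,
    ← ENNReal.rpow_mul, show (1 / 2 : ℝ) * ((2 : ℕ) : ℝ) = 1 by norm_num, ENNReal.rpow_one,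
    ENNReal.rpow_one]
  apply le_of_eq
  congr 1
  · apply lintegral_congr_ae
    filter_upwards [hpos] with x hx
    rw [ENNReal.rpow_two, ← ENNReal.ofReal_pow (by positivity), mul_pow, Real.sq_sqrt hx.le]
  · apply lintegral_congr_ae
    filter_upwards [hpos] with x hx
    rw [ENNReal.rpow_two, ← ENNReal.ofReal_pow (by positivity), mul_pow, Real.sq_sqrt (by positivity)]

lemma snd_schwartz (f : SchwartzMap ℝ ℂ) : ∃ K : ℝ, 0 < K ∧
    ∀ x, ‖f x‖ ≤ K * (1 + |x|) ^ (-4 : ℝ) := by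
  have h := fun x => SchwartzMap.one_add_le_sup_seminorm_apply (𝕜 := ℝ) (m := (4,0)) le_rfl le_rfl f x
  simp only [norm_iteratedFDeriv_zero, Real.norm_eq_abs] at h
  set S := 2 ^ 4 * ((Finset.Iic ((4:ℕ),(0:ℕ))).sup fun m => SchwartzMap.seminorm ℝ m.1 m.2) f
  refine ⟨|S| + 1, by positivity, fun x => ?_⟩
  have h0 : 0 < 1 + |x| := by positivity
  rw [Real.rpow_neg h0.le, show (4:ℝ) = ((4:ℕ):ℝ) by norm_num, Real.rpow_natCast,
    ← div_eq_mul_inv, le_div_iff₀ (by positivity), mul_comm]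
  exact (h x).trans (by linarith [le_abs_self S])

/-- A bump function and its transforms. -/
lemma snd_bump (c R : ℝ) (hR : 0 < R) : ∃ (χ : ℝ → ℝ) (Y : ℝ → ℂ) (K : ℝ), 0 < K ∧
    Continuous χ ∧ Integrable χ ∧ (∀ s, 0 ≤ χ s) ∧ (∀ s, R ≤ |s - c| → χ s = 0) ∧ χ c = 1 ∧
    0 < ∫ s, χ s ∧
    Continuous Y ∧ (∀ u, ‖Y u‖ ≤ K * (1 + |u|) ^ (-4 : ℝ)) ∧ Integrable Y ∧
    ∀ s : ℝ, ∫ τ : ℝ, Complex.exp (-Complex.I * s * τ) * Y τ = χ s := by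
  let b : ContDiffBump c := ⟨R / 2, R, by positivity, by linarith⟩
  have hsupp : HasCompactSupport (fun s => ((b s : ℝ) : ℂ)) :=
    b.hasCompactSupport.comp_left Complex.ofReal_zero
  have hcd : ContDiff ℝ (⊤ : ℕ∞) (fun s => ((b s : ℝ) : ℂ)) :=
    Complex.ofRealCLM.contDiff.comp b.contDiff
  let B : SchwartzMap ℝ ℂ := hsupp.toSchwartzMap hcd
  let X : SchwartzMap ℝ ℂ := 𝓕⁻ B
  have hX : ∀ s, ∫ v : ℝ, Complex.exp (↑(-2 * Real.pi * v * s) * Complex.I) • X v = b s := by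
    intro s
    have h' : 𝓕 X = B := FourierTransform.fourier_fourierInv_eq B
    have h : 𝓕 (X : ℝ → ℂ) s = B s := by
      rw [← SchwartzMap.fourier_coe, h']
    rw [Real.fourier_real_eq_integral_exp_smul] at h
    exact h
  obtain ⟨K, hK, hKX⟩ := snd_schwartz X
  have hpi := Real.pi_pos
  let D : ℝ := (2 * Real.pi) ^ 4
  refine ⟨b, fun u => (2 * Real.pi : ℂ)⁻¹ * X (u / (2 * Real.pi)), (2 * Real.pi)⁻¹ * K * D,
    by positivity, b.continuous, b.continuous.integrable_of_hasCompactSupport b.hasCompactSupport,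
    fun s => b.nonneg, ?_, ?_, ?_, ?_, ?_, ?_, ?_⟩
  · intro s hs
    exact b.zero_of_le_dist (by simpa [Real.dist_eq] using hs)
  · exact b.one_of_mem_closedBall (by simp; positivity)
  · exact b.integral_pos
  · have := X.continuous
    fun_prop
  · intro u
    have h1 := hKX (u / (2 * Real.pi))
    rw [norm_mul]
    have h2 : ‖(2 * Real.pi : ℂ)⁻¹‖ = (2 * Real.pi)⁻¹ := by
      simp [abs_of_pos hpi]
    rw [h2, mul_assoc, mul_assoc]
    gcongr
    refine h1.trans ?_
    gcongr
    have h3 : (1 + |u|) / (2 * Real.pi) ≤ 1 + |u / (2 * Real.pi)| := by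
      rw [abs_div, abs_of_pos (by positivity : 0 < 2 * Real.pi), add_div]
      gcongr
      rw [div_le_one (by positivity)]
      linarith [Real.pi_gt_three]
    refine (Real.rpow_le_rpow_of_nonpos (by positivity) h3 (by norm_num)).trans ?_
    rw [Real.div_rpow (by positivity) (by positivity), Real.rpow_neg (by positivity : 0 ≤ 2 * Real.pi)]
    apply le_of_eq
    simp only [D]
    rw [show (4:ℝ) = ((4:ℕ):ℝ) by norm_num, Real.rpow_natCast]
    field_simp
  · exact (X.integrable.comp_div (by positivity)).const_mul _
  · intro s
    rw [← hX s]
    have h := Measure.integral_comp_div (fun v : ℝ => Complex.exp (↑(-2 * Real.pi * v * s) * Complex.I) • X v) (2 * Real.pi)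
    rw [abs_of_pos (by positivity)] at h
    have h' := congrArg (fun z : ℂ => (2 * Real.pi : ℂ)⁻¹ * z) h
    rw [← integral_const_mul] at h'
    have e : (2 * Real.pi : ℂ) ≠ 0 := by
      simp [hpi.ne']
    have : (2 * Real.pi : ℂ)⁻¹ * ((2 * Real.pi : ℝ) • ∫ v : ℝ, Complex.exp (↑(-2 * Real.pi * v * s) * Complex.I) • X v) = ∫ v : ℝ, Complex.exp (↑(-2 * Real.pi * v * s) * Complex.I) • X v := by
      rw [Complex.real_smul, ← mul_assoc]
      push_cast
      rw [inv_mul_cancel₀ e, one_mul]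
    rw [this] at h'
    rw [← h']
    congr 1
    ext τ
    rw [smul_eq_mul, mul_left_comm]
    congr 2
    congr 1
    push_cast
    field_simp

lemma snd_psi : ∃ (Ψ : ℝ → ℂ) (K : ℝ), 0 < K ∧ Continuous Ψ ∧ Integrable Ψ ∧
    (∀ u, ‖Ψ u‖ ≤ K * (1 + |u|) ^ (-4 : ℝ)) ∧
    (∫ u in Ioi (0:ℝ), Ψ u ≠ 0) ∧
    ∀ z : ℝ, 1 ≤ |z| → ∫ u in Ioi (0:ℝ), Ψ u * (Real.cos (z * u) : ℂ) = 0 := by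
  obtain ⟨χ, Y, K, hK, -, -, -, h0, h1, -, hYc, hYK, hYi, hY⟩ := snd_bump 0 1 one_pos
  have hYn : Integrable (fun u => Y (-u)) := hYi.comp_neg
  have key : ∀ z : ℝ, ∫ u in Ioi (0:ℝ), (Y u + Y (-u)) * (Real.cos (z * u) : ℂ)
      = ((χ z : ℂ) + χ (-z)) / 2 := by
    intro z
    have hb : ∀ s : ℝ, Integrable (fun τ : ℝ => Complex.exp (-Complex.I * s * τ) * Y τ) := by
      intro s
      refine hYi.bdd_mul (c := 1) (by fun_prop) (Filter.Eventually.of_forall fun τ => ?_)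
      rw [Complex.norm_exp]; simp
    have hi : Integrable (fun u : ℝ => Y u * (Real.cos (z * u) : ℂ)) := by
      refine hYi.mul_bdd (c := 1) (by fun_prop) (Filter.Eventually.of_forall fun τ => ?_)
      rw [Complex.norm_real]; exact Real.abs_cos_le_one _
    have e1 : ∫ u, Y u * (Real.cos (z * u) : ℂ) = ((χ z : ℂ) + χ (-z)) / 2 := by
      rw [← hY z, ← hY (-z), ← integral_add (hb _) (hb _), ← integral_div]
      congr 1; ext u
      rw [Complex.ofReal_cos, Complex.cos]
      push_cast
      rw [show (z:ℂ) * u * Complex.I = -Complex.I * -z * u by ring,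
        show -((z:ℂ) * u) * Complex.I = -Complex.I * z * u by ring]
      ring
    rw [← e1, ← integral_add_compl (measurableSet_Ioi (a := (0:ℝ))) hi, compl_Ioi]
    have e2 : ∫ u in Iic (0:ℝ), Y u * (Real.cos (z * u) : ℂ)
        = ∫ u in Ioi (0:ℝ), Y (-u) * (Real.cos (z * u) : ℂ) := by
      have := integral_comp_neg_Ioi (0:ℝ) (fun u => Y u * (Real.cos (z * u) : ℂ))
      simp only [neg_zero] at this
      rw [← this]
      simp
    rw [e2, ← integral_add hi.integrableOn]
    · simp only [add_mul]
    · have := hi.comp_neg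
      refine Integrable.integrableOn ?_
      simpa using this
  refine ⟨fun u => Y u + Y (-u), K + K, by positivity, by fun_prop, hYi.add hYn, ?_, ?_, ?_⟩
  · intro u
    refine (norm_add_le _ _).trans ?_
    have := hYK (-u)
    rw [abs_neg] at this
    rw [add_mul]
    exact add_le_add (hYK u) this
  · have := key 0
    simp only [zero_mul, Real.cos_zero, Complex.ofReal_one, mul_one, neg_zero, h1] at this
    rw [this]; norm_num
  · intro z hz
    rw [key z, h0 z (by simpa using hz), h0 (-z) (by simpa using hz)]
    simp


/-- Radial part of the kernel. -/
noncomputable def sndGk (t τ ρ : ℝ) : ℂ :=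
  (1 / (2 * (ρ : ℂ))) *
    ((Complex.exp (-Complex.I * (t : ℂ) * (τ : ℂ)) -
        Complex.exp (Complex.I * (t : ℂ) * (ρ : ℂ))) / ((τ : ℂ) + (ρ : ℂ)) -
      (Complex.exp (-Complex.I * (t : ℂ) * (τ : ℂ)) -
        Complex.exp (-Complex.I * (t : ℂ) * (ρ : ℂ))) / ((τ : ℂ) - (ρ : ℂ)))

lemma sndGk_eq {t τ ρ : ℝ} (ht : 0 ≤ t) (hρ : 0 < ρ) (h1 : τ - ρ ≠ 0) (h2 : τ + ρ ≠ 0) :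
    sndGk t τ ρ = ∫ s in Ioc 0 t, Complex.exp (-Complex.I * s * τ) *
      ((Real.sin ((t - s) * ρ) / ρ : ℝ) : ℂ) := by
  have h1' : (τ : ℂ) - ρ ≠ 0 := by exact_mod_cast h1
  have h2' : (τ : ℂ) + ρ ≠ 0 := by exact_mod_cast h2
  have hρ' : (ρ : ℂ) ≠ 0 := by exact_mod_cast hρ.ne'
  have hI := Complex.I_ne_zero
  rw [← intervalIntegral.integral_of_le ht]
  have e : ∀ s : ℝ, Complex.exp (-Complex.I * s * τ) * ((Real.sin ((t - s) * ρ) / ρ : ℝ) : ℂ)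
      = (Complex.I / (2 * ρ) * Complex.exp (-Complex.I * t * ρ)) *
          Complex.exp ((-Complex.I * (τ - ρ)) * s)
        - (Complex.I / (2 * ρ) * Complex.exp (Complex.I * t * ρ)) *
          Complex.exp ((-Complex.I * (τ + ρ)) * s) := by
    intro s
    push_cast
    rw [Complex.sin]
    have a1 : Complex.exp (-(((t:ℂ) - s) * ρ) * Complex.I) =
      Complex.exp (-Complex.I * t * ρ) * Complex.exp (Complex.I * ρ * s) := by
      rw [← Complex.exp_add]; ring_nf
    have a2 : Complex.exp ((((t:ℂ) - s) * ρ) * Complex.I) =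
      Complex.exp (Complex.I * t * ρ) * Complex.exp (-Complex.I * ρ * s) := by
      rw [← Complex.exp_add]; ring_nf
    have a3 : Complex.exp ((-Complex.I * ((τ:ℂ) - ρ)) * s) =
      Complex.exp (-Complex.I * s * τ) * Complex.exp (Complex.I * ρ * s) := by
      rw [← Complex.exp_add]; ring_nf
    have a4 : Complex.exp ((-Complex.I * ((τ:ℂ) + ρ)) * s) =
      Complex.exp (-Complex.I * s * τ) * Complex.exp (-Complex.I * ρ * s) := by
      rw [← Complex.exp_add]; ring_nf
    rw [a1, a2, a3, a4]
    field_simp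
  simp_rw [e]
  have c1 : -Complex.I * ((τ : ℂ) - ρ) ≠ 0 := mul_ne_zero (neg_ne_zero.mpr hI) h1'
  have c2 : -Complex.I * ((τ : ℂ) + ρ) ≠ 0 := mul_ne_zero (neg_ne_zero.mpr hI) h2'
  rw [intervalIntegral.integral_sub (Continuous.intervalIntegrable (by fun_prop) _ _)
    (Continuous.intervalIntegrable (by fun_prop) _ _), intervalIntegral.integral_const_mul,
    intervalIntegral.integral_const_mul, integral_exp_mul_complex c1, integral_exp_mul_complex c2]
  have a3 : Complex.exp ((-Complex.I * ((τ:ℂ) - ρ)) * t) =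
      Complex.exp (-Complex.I * t * τ) * Complex.exp (Complex.I * t * ρ) := by
      rw [← Complex.exp_add]; ring_nf
  have a4 : Complex.exp ((-Complex.I * ((τ:ℂ) + ρ)) * t) =
      Complex.exp (-Complex.I * t * τ) * Complex.exp (-Complex.I * t * ρ) := by
      rw [← Complex.exp_add]; ring_nf
  have a5 : Complex.exp (Complex.I * t * ρ) * Complex.exp (-Complex.I * t * ρ) = 1 := by
    rw [← Complex.exp_add]; ring_nf; simp
  rw [a3, a4, sndGk]
  simp only [Complex.ofReal_zero, mul_zero, Complex.exp_zero]
  generalize Complex.exp (Complex.I * t * ρ) = P at *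
  generalize Complex.exp (-Complex.I * t * ρ) = Q at *
  generalize Complex.exp (-Complex.I * t * τ) = S at *
  have l1 : Complex.I / (2 * ρ) * Q * ((S * P - 1) / (-Complex.I * ((τ:ℂ) - ρ)))
      = -(1 / (2 * ρ)) * ((S * (P * Q) - Q) / ((τ:ℂ) - ρ)) := by
    field_simp
  have l2 : Complex.I / (2 * ρ) * P * ((S * Q - 1) / (-Complex.I * ((τ:ℂ) + ρ)))
      = -(1 / (2 * ρ)) * ((S * (P * Q) - P) / ((τ:ℂ) + ρ)) := by
    field_simp
  rw [l1, l2, a5]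
  ring

noncomputable def sndW (Y : ℝ → ℂ) (t τ ρ : ℝ) : ℂ :=
  (Complex.exp (Complex.I * t * ρ) * Y (τ - ρ) - Complex.exp (-Complex.I * t * ρ) * Y (τ + ρ)) /
    (2 * Complex.I)

lemma sndW_integrable {Y : ℝ → ℂ} (hY : Integrable Y) (t ρ : ℝ) :
    Integrable (fun τ => sndW Y t τ ρ) := by
  unfold sndW
  exact (((hY.comp_sub_right ρ).const_mul _).sub ((hY.comp_add_right ρ).const_mul _)).div_const _

lemma snd_exp_norm (s τ : ℝ) : ‖Complex.exp (-Complex.I * s * τ)‖ = 1 := by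
  rw [Complex.norm_exp]; simp

lemma sndW_fourier {Y : ℝ → ℂ} (hY : Integrable Y) {χ : ℝ → ℝ}
    (h : ∀ s : ℝ, ∫ τ : ℝ, Complex.exp (-Complex.I * s * τ) * Y τ = χ s) (t ρ s : ℝ) :
    ∫ τ : ℝ, Complex.exp (-Complex.I * s * τ) * sndW Y t τ ρ = 
      ((Real.sin ((t - s) * ρ) * χ s : ℝ) : ℂ) := by
  have hb : ∀ f : ℝ → ℂ, Integrable f →
      Integrable (fun τ : ℝ => Complex.exp (-Complex.I * s * τ) * f τ) := by
    intro f hf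
    exact hf.bdd_mul (c := 1) (by fun_prop)
      (Filter.Eventually.of_forall fun τ => (snd_exp_norm s τ).le)
  have t1 : ∫ τ : ℝ, Complex.exp (-Complex.I * s * τ) * Y (τ - ρ)
      = Complex.exp (-Complex.I * s * ρ) * χ s := by
    rw [← h s, ← integral_const_mul]
    rw [← integral_sub_right_eq_self (fun τ : ℝ => Complex.exp (-Complex.I * s * ρ) *
      (Complex.exp (-Complex.I * s * τ) * Y τ)) ρ]
    congr 1; ext τ
    rw [← mul_assoc, ← Complex.exp_add]
    push_cast
    ring_nf
  have t2 : ∫ τ : ℝ, Complex.exp (-Complex.I * s * τ) * Y (τ + ρ)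
      = Complex.exp (Complex.I * s * ρ) * χ s := by
    rw [← h s, ← integral_const_mul]
    rw [← integral_add_right_eq_self (fun τ : ℝ => Complex.exp (Complex.I * s * ρ) *
      (Complex.exp (-Complex.I * s * τ) * Y τ)) ρ]
    congr 1; ext τ
    rw [← mul_assoc, ← Complex.exp_add]
    push_cast
    ring_nf
  have e : ∀ τ : ℝ, Complex.exp (-Complex.I * s * τ) * sndW Y t τ ρ =
    (Complex.exp (Complex.I * t * ρ) / (2 * Complex.I)) *
      (Complex.exp (-Complex.I * s * τ) * Y (τ - ρ)) -
    (Complex.exp (-Complex.I * t * ρ) / (2 * Complex.I)) *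
      (Complex.exp (-Complex.I * s * τ) * Y (τ + ρ)) := by
    intro τ; unfold sndW; ring
  simp_rw [e]
  rw [integral_sub ((hb _ (hY.comp_sub_right ρ)).const_mul _)
    ((hb _ (hY.comp_add_right ρ)).const_mul _), integral_const_mul, integral_const_mul, t1, t2]
  push_cast
  rw [Complex.sin]
  have a1 : Complex.exp (-(((t:ℂ) - s) * ρ) * Complex.I) =
      Complex.exp (-Complex.I * t * ρ) * Complex.exp (Complex.I * s * ρ) := by
      rw [← Complex.exp_add]; ring_nf
  have a2 : Complex.exp ((((t:ℂ) - s) * ρ) * Complex.I) =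
      Complex.exp (Complex.I * t * ρ) * Complex.exp (-Complex.I * s * ρ) := by
      rw [← Complex.exp_add]; ring_nf
  rw [a1, a2]
  have hI := Complex.I_ne_zero
  field_simp
  rw [Complex.I_sq]
  ring

lemma snd_pair_integrable_prod {W : ℝ → ℂ} (hW : Integrable W) (t' ρ : ℝ) :
    Integrable (fun p : ℝ × ℝ => (Complex.exp (-Complex.I * p.2 * p.1) *
      ((Real.sin ((t' - p.2) * ρ) / ρ : ℝ) : ℂ)) * W p.1)
      (volume.prod (volume.restrict (Ioc 0 t'))) := by
  have h1 : Integrable (fun p : ℝ × ℝ => W p.1 * (1:ℂ)) (volume.prod (volume.restrict (Ioc 0 t'))) :=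
    hW.mul_prod (integrable_const (1:ℂ))
  simp only [mul_one] at h1
  refine h1.bdd_mul (c := |ρ|⁻¹) (Continuous.aestronglyMeasurable (by fun_prop)) (Filter.Eventually.of_forall fun p => ?_)
  rw [norm_mul, snd_exp_norm, one_mul, Complex.norm_real, Real.norm_eq_abs, abs_div, div_eq_mul_inv]
  exact mul_le_of_le_one_left (by positivity) (Real.abs_sin_le_one _)

lemma snd_ae_ne (ρ : ℝ) : ∀ᵐ τ : ℝ, τ - ρ ≠ 0 ∧ τ + ρ ≠ 0 := by
  have h1 : ∀ᵐ τ : ℝ, τ ≠ ρ := by simp [ae_iff, measure_singleton]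
  have h2 : ∀ᵐ τ : ℝ, τ ≠ -ρ := by simp [ae_iff, measure_singleton]
  filter_upwards [h1, h2] with τ a b
  exact ⟨sub_ne_zero.mpr a, fun h => b (by linarith)⟩

lemma snd_pair {Y : ℝ → ℂ} (hY : Integrable Y) {χ : ℝ → ℝ}
    (h : ∀ s : ℝ, ∫ τ : ℝ, Complex.exp (-Complex.I * s * τ) * Y τ = χ s) {t t' ρ : ℝ}
    (ht' : 0 ≤ t') (hρ : 0 < ρ) (hχ : ∀ s, s ∉ Ioc 0 t' → χ s = 0) :
    Integrable (fun τ => sndGk t' τ ρ * sndW Y t τ ρ) ∧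
    ∫ τ, sndGk t' τ ρ * sndW Y t τ ρ =
      ((ρ⁻¹ * ∫ s, χ s * (Real.sin ((t' - s) * ρ) * Real.sin ((t - s) * ρ)) : ℝ) : ℂ) := by
  have hint := snd_pair_integrable_prod (sndW_integrable hY t ρ) t' ρ
  have e1 : (fun τ => sndGk t' τ ρ * sndW Y t τ ρ) =ᵐ[volume] fun τ =>
      ∫ s in Ioc 0 t', (Complex.exp (-Complex.I * s * τ) *
      ((Real.sin ((t' - s) * ρ) / ρ : ℝ) : ℂ)) * sndW Y t τ ρ := by
    filter_upwards [snd_ae_ne ρ] with τ hτ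
    rw [sndGk_eq ht' hρ hτ.1 hτ.2, integral_mul_const]
  refine ⟨hint.integral_prod_left.congr e1.symm, ?_⟩
  rw [integral_congr_ae e1, integral_integral_swap hint]
  have e2 : ∀ s : ℝ, ∫ τ : ℝ, (Complex.exp (-Complex.I * s * τ) *
      ((Real.sin ((t' - s) * ρ) / ρ : ℝ) : ℂ)) * sndW Y t τ ρ = 
      ((ρ⁻¹ * (χ s * (Real.sin ((t' - s) * ρ) * Real.sin ((t - s) * ρ))) : ℝ) : ℂ) := by
    intro s
    have := sndW_fourier hY h t ρ s
    rw [show (fun τ : ℝ => (Complex.exp (-Complex.I * s * τ) *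
      ((Real.sin ((t' - s) * ρ) / ρ : ℝ) : ℂ)) * sndW Y t τ ρ) = fun τ : ℝ =>
      ((Real.sin ((t' - s) * ρ) / ρ : ℝ) : ℂ) * (Complex.exp (-Complex.I * s * τ) * sndW Y t τ ρ)
      by ext τ; ring, integral_const_mul, this]
    push_cast
    ring
  simp_rw [e2]
  rw [integral_complex_ofReal, integral_const_mul]
  rw [setIntegral_eq_integral_of_forall_compl_eq_zero]
  intro s hs
  rw [hχ s hs, zero_mul]

lemma snd_half {Ψ : ℝ → ℂ} (hΨi : Integrable Ψ)
    (hΨ : ∀ z : ℝ, 1 ≤ |z| → ∫ u in Ioi (0:ℝ), Ψ u * (Real.cos (z * u) : ℂ) = 0)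
    {χ : ℝ → ℝ} (hχi : Integrable χ) {t t' r : ℝ} (hr : 0 < r)
    (hχ : ∀ s, χ s ≠ 0 → r ≤ t' + t - 2 * s) :
    ∫ ρ in Ioi (0:ℝ), Ψ (r * ρ) *
        ((∫ s, χ s * (Real.sin ((t' - s) * ρ) * Real.sin ((t - s) * ρ)) : ℝ) : ℂ) =
      ((∫ s, χ s : ℝ) : ℂ) / (2 * r) *
        ∫ u in Ioi (0:ℝ), Ψ u * (Real.cos ((t' - t) / r * u) : ℂ) := by
  have hΨr : Integrable (fun ρ => Ψ (r * ρ)) := hΨi.comp_mul_left' hr.ne'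
  have scale : ∀ z : ℝ, ∫ ρ in Ioi (0:ℝ), Ψ (r * ρ) * (Real.cos (z * ρ) : ℂ)
      = (r : ℂ)⁻¹ * ∫ u in Ioi (0:ℝ), Ψ u * (Real.cos (z / r * u) : ℂ) := by
    intro z
    have := integral_comp_mul_left_Ioi (fun u => Ψ u * (Real.cos (z / r * u) : ℂ)) 0 hr
    rw [mul_zero, Complex.real_smul, Complex.ofReal_inv] at this
    rw [← this]
    congr 1; ext ρ
    rw [show z / r * (r * ρ) = z * ρ by field_simp]
  have hint : Integrable (fun p : ℝ × ℝ => ((Real.sin ((t' - p.2) * p.1) *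
      Real.sin ((t - p.2) * p.1) : ℝ) : ℂ) * (Ψ (r * p.1) * (χ p.2 : ℂ)))
      ((volume.restrict (Ioi 0)).prod volume) := by
    have h1 := (hΨr.integrableOn (s := Ioi 0)).mul_prod (ν := volume) (hχi.ofReal (𝕜 := ℂ))
    refine h1.bdd_mul (c := 1) (Continuous.aestronglyMeasurable (by fun_prop)) (Filter.Eventually.of_forall fun p => ?_)
    rw [Complex.norm_real, Real.norm_eq_abs, abs_mul]
    exact mul_le_one₀ (Real.abs_sin_le_one _) (abs_nonneg _) (Real.abs_sin_le_one _)
  have e1 : ∀ ρ : ℝ, Ψ (r * ρ) *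
        ((∫ s, χ s * (Real.sin ((t' - s) * ρ) * Real.sin ((t - s) * ρ)) : ℝ) : ℂ)
      = ∫ s, ((Real.sin ((t' - s) * ρ) *
      Real.sin ((t - s) * ρ) : ℝ) : ℂ) * (Ψ (r * ρ) * (χ s : ℂ)) := by
    intro ρ
    rw [← integral_complex_ofReal, ← integral_const_mul]
    congr 1; ext s
    push_cast; ring
  simp_rw [e1]
  rw [integral_integral_swap hint]
  have hc : ∀ z : ℝ, IntegrableOn (fun ρ : ℝ => Ψ (r * ρ) * (Real.cos (z * ρ) : ℂ)) (Ioi 0) := by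
    intro z
    refine Integrable.integrableOn ?_
    refine hΨr.mul_bdd (c := 1) (by fun_prop) (Filter.Eventually.of_forall fun τ => ?_)
    rw [Complex.norm_real]; exact Real.abs_cos_le_one _
  have e2 : ∀ s : ℝ, ∫ ρ in Ioi (0:ℝ), ((Real.sin ((t' - s) * ρ) *
      Real.sin ((t - s) * ρ) : ℝ) : ℂ) * (Ψ (r * ρ) * (χ s : ℂ)) =
      (χ s : ℂ) * (1 / (2 * r) *
        ∫ u in Ioi (0:ℝ), Ψ u * (Real.cos ((t' - t) / r * u) : ℂ)) := by
    intro s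
    have id1 : ∀ ρ : ℝ, ((Real.sin ((t' - s) * ρ) *
      Real.sin ((t - s) * ρ) : ℝ) : ℂ) * (Ψ (r * ρ) * (χ s : ℂ)) =
      (χ s : ℂ) / 2 * (Ψ (r * ρ) * (Real.cos ((t' - t) * ρ) : ℂ) -
        Ψ (r * ρ) * (Real.cos ((t' + t - 2 * s) * ρ) : ℂ)) := by
      intro ρ
      have : Real.sin ((t' - s) * ρ) * Real.sin ((t - s) * ρ) =
        (Real.cos ((t' - t) * ρ) - Real.cos ((t' + t - 2 * s) * ρ)) / 2 := by
        rw [show (t' - t) * ρ = (t' - s) * ρ - (t - s) * ρ by ring,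
          show (t' + t - 2 * s) * ρ = (t' - s) * ρ + (t - s) * ρ by ring,
          Real.cos_sub, Real.cos_add]
        ring
      rw [this]
      push_cast; ring
    simp_rw [id1]
    rw [integral_const_mul, integral_sub (hc _) (hc _), scale, scale]
    by_cases hs : χ s = 0
    · simp [hs]
    · rw [hΨ ((t' + t - 2 * s) / r)]
      · ring
      · rw [abs_div, abs_of_pos hr, le_div_iff₀ hr, one_mul]
        exact (hχ s hs).trans (le_abs_self _)
  simp_rw [e2]
  rw [integral_mul_const, integral_complex_ofReal]
  ring


lemma snd_J_integrable : Integrable (fun u : ℝ => (1 + |u|) ^ (-2 : ℝ)) := by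
  have := integrable_one_add_norm (E := ℝ) (μ := volume) (r := 2) (by simp)
  simpa using this

lemma snd_tau_bound {K p : ℝ} (hp0 : 0 ≤ p) (hp1 : p < 1) {Y : ℝ → ℂ}
    (hY : ∀ u, ‖Y u‖ ≤ K * (1 + |u|) ^ (-4 : ℝ)) {τ ρ v : ℝ} (hv : |τ| ≤ |v| + ρ) (hρ : 0 < ρ) :
    ‖Y v‖ ^ 2 * |τ| ^ p ≤ K ^ 2 * (1 + ρ) ^ p * (1 + |v|) ^ (-2 : ℝ) := by
  have hv0 : 0 < 1 + |v| := by positivity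
  have h1 : ‖Y v‖ ^ 2 ≤ K ^ 2 * (1 + |v|) ^ (-8 : ℝ) := by
    refine (pow_le_pow_left₀ (norm_nonneg _) (hY v) 2).trans (le_of_eq ?_)
    rw [mul_pow, ← Real.rpow_natCast ((1 + |v|) ^ (-4 : ℝ)), ← Real.rpow_mul hv0.le]
    norm_num
  have h2 : |τ| ^ p ≤ (1 + |v|) ^ p * (1 + ρ) ^ p := by
    rw [← Real.mul_rpow (by positivity) (by positivity)]
    apply Real.rpow_le_rpow (abs_nonneg _) _ hp0
    nlinarith [abs_nonneg v]
  have h3 : (1 + |v|) ^ (-8 : ℝ) * (1 + |v|) ^ p ≤ (1 + |v|) ^ (-2 : ℝ) := by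
    rw [← Real.rpow_add hv0]
    apply Real.rpow_le_rpow_of_exponent_le (by linarith [abs_nonneg v])
    linarith
  calc _ ≤ (K ^ 2 * (1 + |v|) ^ (-8 : ℝ)) * ((1 + |v|) ^ p * (1 + ρ) ^ p) := by gcongr
    _ = K ^ 2 * (1 + ρ) ^ p * ((1 + |v|) ^ (-8 : ℝ) * (1 + |v|) ^ p) := by ring
    _ ≤ _ := by gcongr

lemma snd_rho_bound {K p q : ℝ} (hp0 : 0 ≤ p) (hp1 : p < 1) (hq0 : 0 < q) (hq3 : q < 3)
    {Y : ℝ → ℂ} (hY : ∀ u, ‖Y u‖ ≤ K * (1 + |u|) ^ (-4 : ℝ)) {r ρ : ℝ} (hr : 0 < r) (hr1 : r ≤ 1)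
    (hρ : 0 < ρ) :
    ‖Y (r * ρ)‖ ^ 2 * ρ ^ q * (1 + ρ) ^ p ≤ K ^ 2 * r ^ (-q - p) * (1 + |r * ρ|) ^ (-2 : ℝ) := by
  have hu : 0 < r * ρ := by positivity
  rw [abs_of_pos hu]
  have hY' := hY (r * ρ)
  rw [abs_of_pos hu] at hY'
  set u := r * ρ with hudef
  have hv0 : 0 < 1 + u := by positivity
  have h1 : ‖Y u‖ ^ 2 ≤ K ^ 2 * (1 + u) ^ (-8 : ℝ) := by
    refine (pow_le_pow_left₀ (norm_nonneg _) hY' 2).trans (le_of_eq ?_)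
    rw [mul_pow, ← Real.rpow_natCast ((1 + u) ^ (-4 : ℝ)), ← Real.rpow_mul hv0.le]
    norm_num
  have h2 : ρ ^ q ≤ r ^ (-q) * (1 + u) ^ q := by
    have : ρ = r⁻¹ * u := by rw [hudef]; field_simp
    rw [this, Real.mul_rpow (by positivity) hu.le, Real.rpow_neg hr.le, Real.inv_rpow hr.le]
    gcongr
    linarith
  have h3 : (1 + ρ) ^ p ≤ r ^ (-p) * (1 + u) ^ p := by
    rw [Real.rpow_neg hr.le, ← Real.inv_rpow hr.le, ← Real.mul_rpow (by positivity) hv0.le]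
    apply Real.rpow_le_rpow (by positivity) _ hp0
    rw [inv_mul_eq_div, le_div_iff₀ hr]
    nlinarith
  have h4 : (1 + u) ^ (-8 : ℝ) * (1 + u) ^ q * (1 + u) ^ p ≤ (1 + u) ^ (-2 : ℝ) := by
    rw [← Real.rpow_add hv0, ← Real.rpow_add hv0]
    apply Real.rpow_le_rpow_of_exponent_le (by linarith)
    linarith
  calc _ ≤ (K ^ 2 * (1 + u) ^ (-8 : ℝ)) * (r ^ (-q) * (1 + u) ^ q) * (r ^ (-p) * (1 + u) ^ p) := by
        gcongr
    _ = K ^ 2 * (r ^ (-q) * r ^ (-p)) * ((1 + u) ^ (-8 : ℝ) * (1 + u) ^ q * (1 + u) ^ p) := by ring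
    _ ≤ K ^ 2 * (r ^ (-q) * r ^ (-p)) * (1 + u) ^ (-2 : ℝ) := by gcongr
    _ = _ := by rw [← Real.rpow_add hr, ← sub_eq_add_neg]

lemma sndW_norm_sq (Y : ℝ → ℂ) (t τ ρ : ℝ) :
    ‖sndW Y t τ ρ‖ ^ 2 ≤ ‖Y (τ - ρ)‖ ^ 2 + ‖Y (τ + ρ)‖ ^ 2 := by
  have h1 : ‖Complex.exp (Complex.I * t * ρ)‖ = 1 := by rw [Complex.norm_exp]; simp
  have h : ‖sndW Y t τ ρ‖ ≤ (‖Y (τ - ρ)‖ + ‖Y (τ + ρ)‖) / 2 := by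
    unfold sndW
    rw [norm_div, norm_mul, Complex.norm_I, mul_one, Complex.norm_ofNat]
    gcongr
    refine (norm_sub_le _ _).trans ?_
    rw [norm_mul, norm_mul, snd_exp_norm, h1, one_mul, one_mul]
  refine (pow_le_pow_left₀ (norm_nonneg _) h 2).trans ?_
  nlinarith [sq_nonneg (‖Y (τ - ρ)‖ - ‖Y (τ + ρ)‖), sq_nonneg (‖Y (τ - ρ)‖), sq_nonneg (‖Y (τ + ρ)‖)]

lemma sndW_measurable {Y : ℝ → ℂ} (hY : Continuous Y) (t : ℝ) :
    Measurable (fun z : ℝ × ℝ => sndW Y t z.1 z.2) := by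
  unfold sndW
  apply Continuous.measurable
  fun_prop

lemma snd_B {K K' p q : ℝ} (hp0 : 0 ≤ p) (hp1 : p < 1) (hq0 : 0 < q) (hq3 : q < 3)
    {Y Ψ : ℝ → ℂ} (hYc : Continuous Y) (hΨc : Continuous Ψ)
    (hY : ∀ u, ‖Y u‖ ≤ K * (1 + |u|) ^ (-4 : ℝ)) (hΨ : ∀ u, ‖Ψ u‖ ≤ K' * (1 + |u|) ^ (-4 : ℝ)) :
    ∃ C : ℝ, 0 < C ∧ ∀ t r : ℝ, 0 < r → r ≤ 1 →
      ∫⁻ z, ENNReal.ofReal (‖sndW Y t z.1 z.2 * (Ψ (r * z.2) * z.2)‖ ^ 2 *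
        (|z.1| ^ (-p) * z.2 ^ (2 - q))⁻¹) ∂((volume : Measure ℝ).prod (volume.restrict (Ioi (0:ℝ))))
      ≤ ENNReal.ofReal (C * r ^ (-1 - q - p)) := by
  set J : ℝ → ℝ := fun u => (1 + |u|) ^ (-2 : ℝ) with hJ
  have hJi : Integrable J := snd_J_integrable
  have hJ0 : ∀ u, 0 ≤ J u := fun u => by simp only [hJ]; positivity
  set I := ∫ u, J u with hI
  have hI0 : 0 ≤ I := integral_nonneg hJ0
  refine ⟨2 * K ^ 2 * I * K' ^ 2 * I + 1, by positivity, fun t r hr hr1 => ?_⟩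
  have hm := sndW_measurable hYc t
  have hΨm := hΨc.measurable
  rw [lintegral_prod_symm _ (by fun_prop)]
  have inner : ∀ ρ ∈ Ioi (0:ℝ), ∫⁻ τ, ENNReal.ofReal (‖sndW Y t τ ρ * (Ψ (r * ρ) * ρ)‖ ^ 2 *
        (|τ| ^ (-p) * ρ ^ (2 - q))⁻¹) ≤
        ENNReal.ofReal (2 * K ^ 2 * I * K' ^ 2 * r ^ (-q - p) * J (r * ρ)) := by
    intro ρ hρ
    have hρ0 : 0 < ρ := hρ
    have pt : ∀ τ : ℝ, ‖sndW Y t τ ρ * (Ψ (r * ρ) * ρ)‖ ^ 2 * (|τ| ^ (-p) * ρ ^ (2 - q))⁻¹ ≤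
        (K ^ 2 * (K' ^ 2 * r ^ (-q - p) * J (r * ρ))) * (J (τ - ρ) + J (τ + ρ)) := by
      intro τ
      have b1 := snd_tau_bound hp0 hp1 hY (τ := τ) (ρ := ρ) (v := τ - ρ)
        (by have := abs_add_le (τ - ρ) ρ; rw [abs_of_pos hρ0] at this; simpa using this) hρ0
      have b2 := snd_tau_bound hp0 hp1 hY (τ := τ) (ρ := ρ) (v := τ + ρ)
        (by have := abs_sub (τ + ρ) ρ; rw [abs_of_pos hρ0] at this; simpa using this) hρ0
      have b3 := snd_rho_bound hp0 hp1 hq0 hq3 hΨ hr hr1 hρ0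
      have e0 : (|τ| ^ (-p) * ρ ^ (2 - q))⁻¹ = |τ| ^ p * (ρ ^ q / ρ ^ 2) := by
        rw [mul_inv, Real.rpow_neg (abs_nonneg _), inv_inv, Real.rpow_sub hρ0, inv_div]
        norm_num
      rw [e0, norm_mul, norm_mul, Complex.norm_real, Real.norm_eq_abs, abs_of_pos hρ0]
      calc _ = ‖sndW Y t τ ρ‖ ^ 2 * |τ| ^ p * (‖Ψ (r * ρ)‖ ^ 2 * ρ ^ q) := by
            field_simp
        _ ≤ (‖Y (τ - ρ)‖ ^ 2 + ‖Y (τ + ρ)‖ ^ 2) * |τ| ^ p * (‖Ψ (r * ρ)‖ ^ 2 * ρ ^ q) := by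
            gcongr
            exact sndW_norm_sq Y t τ ρ
        _ = (‖Y (τ - ρ)‖ ^ 2 * |τ| ^ p + ‖Y (τ + ρ)‖ ^ 2 * |τ| ^ p) * (‖Ψ (r * ρ)‖ ^ 2 * ρ ^ q) := by
            ring
        _ ≤ (K ^ 2 * (1 + ρ) ^ p * J (τ - ρ) + K ^ 2 * (1 + ρ) ^ p * J (τ + ρ)) *
            (‖Ψ (r * ρ)‖ ^ 2 * ρ ^ q) := by
            gcongr
        _ = K ^ 2 * (J (τ - ρ) + J (τ + ρ)) * (‖Ψ (r * ρ)‖ ^ 2 * ρ ^ q * (1 + ρ) ^ p) := by ring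
        _ ≤ K ^ 2 * (J (τ - ρ) + J (τ + ρ)) * (K' ^ 2 * r ^ (-q - p) * J (r * ρ)) := by
            have := hJ0 (τ - ρ)
            have := hJ0 (τ + ρ)
            gcongr
        _ = _ := by ring
    refine (lintegral_mono fun τ => ENNReal.ofReal_le_ofReal (pt τ)).trans ?_
    have hs : Integrable (fun τ => J (τ - ρ) + J (τ + ρ)) := (hJi.comp_sub_right ρ).add (hJi.comp_add_right ρ)
    rw [← ofReal_integral_eq_lintegral_ofReal (hs.const_mul _)]
    · apply ENNReal.ofReal_le_ofReal
      rw [integral_const_mul, integral_add (hJi.comp_sub_right ρ) (hJi.comp_add_right ρ),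
        integral_sub_right_eq_self J, integral_add_right_eq_self J]
      apply le_of_eq
      ring
    · refine Filter.Eventually.of_forall fun τ => ?_
      have := hJ0 (τ - ρ)
      have := hJ0 (τ + ρ)
      have := hJ0 (r * ρ)
      simp only [Pi.zero_apply]
      positivity
  refine (setLIntegral_mono' measurableSet_Ioi inner).trans ?_
  refine (setLIntegral_le_lintegral _ _).trans ?_
  rw [← ofReal_integral_eq_lintegral_ofReal ((hJi.comp_mul_left' hr.ne').const_mul _)]
  · apply ENNReal.ofReal_le_ofReal
    rw [integral_const_mul, Measure.integral_comp_mul_left J r, smul_eq_mul, abs_of_pos (by positivity), ← hI]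
    have : r ^ (-1 - q - p) = r⁻¹ * r ^ (-q - p) := by
      rw [← Real.rpow_neg_one, ← Real.rpow_add hr]
      ring_nf
    rw [this]
    have : 0 < r⁻¹ * r ^ (-q - p) := by positivity
    nlinarith
  · refine Filter.Eventually.of_forall fun τ => ?_
    have := hJ0 (r * τ)
    simp only [Pi.zero_apply]
    positivity

lemma snd_polar (N : ℕ) (hN : 1 ≤ N) (f : ℝ → ℝ≥0∞) (hf : Measurable f) :
    ∫⁻ x : EuclideanSpace ℝ (Fin N), f ‖x‖ =
      ((N : ℝ≥0∞) * volume (Metric.ball (0 : EuclideanSpace ℝ (Fin N)) 1)) *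
        ∫⁻ y in Ioi (0:ℝ), ENNReal.ofReal (y ^ (N - 1)) * f y := by
  set E := EuclideanSpace ℝ (Fin N)
  have hdim : Module.finrank ℝ E = N := by simp [E]
  have : Nontrivial E := Module.nontrivial_of_finrank_pos (R := ℝ) (by rw [hdim]; exact hN)
  have hmp := (volume : Measure E).measurePreserving_homeomorphUnitSphereProd
  calc ∫⁻ x : E, f ‖x‖ = ∫⁻ x : ({(0)}ᶜ : Set E), f (‖x.1‖) ∂((volume : Measure E).comap Subtype.val) := by
        rw [lintegral_subtype_comap (measurableSet_singleton _).compl fun x : E ↦ f (‖x‖),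
          MeasureTheory.restrict_compl_singleton]
    _ = ∫⁻ x, f x.2 ∂((volume : Measure E).toSphere.prod (.volumeIoiPow (Module.finrank ℝ E - 1))) := by
        rw [← hmp.lintegral_comp (f := fun x => f x.2) (by fun_prop)]
        simp
    _ = (∫⁻ x : Ioi (0 : ℝ), f x ∂.volumeIoiPow (Module.finrank ℝ E - 1)) *
          (volume : Measure E).toSphere univ := by
        rw [lintegral_prod _ (by fun_prop)]
        dsimp only
        rw [lintegral_const]
    _ = _ := by
        rw [Measure.toSphere_apply_univ, mul_comm, hdim]
        congr 1
        rw [Measure.volumeIoiPow, lintegral_withDensity_eq_lintegral_mul _ (by fun_prop) (by fun_prop)]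
        simp only [Pi.mul_apply]
        rw [lintegral_subtype_comap measurableSet_Ioi fun a : ℝ ↦ ENNReal.ofReal (a ^ (N - 1)) * f a]


lemma sndGk_measurable (t : ℝ) : Measurable (fun z : ℝ × ℝ => sndGk t z.1 z.2) := by
  unfold sndGk
  fun_prop

lemma Gker_eq (N : ℕ) (t : ℝ) (x : EuclideanSpace ℝ (Fin N)) (τ : ℝ)
    (ξ : EuclideanSpace ℝ (Fin N)) : Gker N t x τ ξ =
      Complex.exp (-Complex.I * ((inner ℝ x ξ : ℝ) : ℂ)) * sndGk t τ ‖ξ‖ := by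
  unfold Gker sndGk
  ring

lemma snd_A (N : ℕ) (hN : 1 ≤ N) (H β : ℝ)
    (hfun : EuclideanSpace ℝ (Fin N) → ℝ) (c₁ : ℝ) (hc₁ : 0 < c₁)
    (hflow : ∀ ξ : EuclideanSpace ℝ (Fin N), ξ ≠ 0 → c₁ * ‖ξ‖ ^ (-β) ≤ hfun ξ)
    (F : ℝ → ℝ → ℂ) (hF : Measurable (fun z : ℝ × ℝ => F z.1 z.2))
    (f : ℝ → EuclideanSpace ℝ (Fin N) → ℂ) (hfF : ∀ τ ξ, ‖f τ ξ‖ = ‖F τ ‖ξ‖‖) :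
    ((N : ℝ≥0∞) * volume (Metric.ball (0 : EuclideanSpace ℝ (Fin N)) 1)) * ENNReal.ofReal c₁ *
      ∫⁻ z, ENNReal.ofReal (‖F z.1 z.2‖ ^ 2 * (|z.1| ^ (1 - 2 * H) * z.2 ^ ((N : ℝ) - 1 - β)))
        ∂((volume : Measure ℝ).prod (volume.restrict (Ioi (0:ℝ)))) ≤ specInt N H hfun f := by
  set V := (N : ℝ≥0∞) * volume (Metric.ball (0 : EuclideanSpace ℝ (Fin N)) 1)
  have : Nontrivial (EuclideanSpace ℝ (Fin N)) :=
    Module.nontrivial_of_finrank_pos (R := ℝ) (by simp; omega)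
  have hF1 : ∀ τ, Measurable (F τ) := fun τ => hF.comp (measurable_const.prodMk measurable_id)
  rw [lintegral_prod _ (by fun_prop), ← lintegral_const_mul _ ?_]
  swap
  · apply Measurable.lintegral_prod_right'
      (f := fun z : ℝ × ℝ => ENNReal.ofReal (‖F z.1 z.2‖ ^ 2 * (|z.1| ^ (1 - 2 * H) * z.2 ^ ((N : ℝ) - 1 - β))))
    fun_prop
  unfold specInt
  apply lintegral_mono
  intro τ
  have hFτ := hF1 τ
  dsimp only
  have h1 : ∫⁻ ξ : EuclideanSpace ℝ (Fin N), ENNReal.ofReal (‖F τ ‖ξ‖‖ ^ 2 * |τ| ^ (1 - 2 * H) *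
      (c₁ * ‖ξ‖ ^ (-β))) ≤
      ∫⁻ ξ : EuclideanSpace ℝ (Fin N), ENNReal.ofReal (‖f τ ξ‖ ^ 2 * |τ| ^ (1 - 2 * H) * hfun ξ) := by
    apply lintegral_mono_ae
    have h0 : ∀ᵐ ξ : EuclideanSpace ℝ (Fin N), ξ ≠ 0 := by simp [ae_iff, measure_singleton]
    filter_upwards [h0] with ξ hξ
    apply ENNReal.ofReal_le_ofReal
    rw [hfF]
    gcongr
    exact hflow ξ hξ
  refine le_trans ?_ h1
  rw [snd_polar N hN (fun ρ => ENNReal.ofReal (‖F τ ρ‖ ^ 2 * |τ| ^ (1 - 2 * H) *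
      (c₁ * ρ ^ (-β)))) (by fun_prop), mul_assoc]
  gcongr
  rw [← lintegral_const_mul _ (by fun_prop)]
  apply le_of_eq
  apply setLIntegral_congr_fun measurableSet_Ioi
  intro ρ hρ
  have hρ0 : 0 < ρ := hρ
  dsimp only
  rw [← ENNReal.ofReal_mul hc₁.le, ← ENNReal.ofReal_mul (by positivity)]
  congr 1
  have : ρ ^ ((N : ℝ) - 1 - β) = ρ ^ (N - 1) * ρ ^ (-β) := by
    rw [← Real.rpow_natCast, ← Real.rpow_add hρ0, Nat.cast_sub hN]
    simp [sub_eq_add_neg]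
  rw [this]
  ring

lemma sndF_measurable {n : ℕ} (t : ℝ) (ts coef : Fin n → ℝ) : Measurable (fun z : ℝ × ℝ =>
    sndGk t z.1 z.2 - ∑ j, (coef j : ℂ) * sndGk (ts j) z.1 z.2) :=
  (sndGk_measurable t).sub (Finset.measurable_fun_sum _ fun j _ =>
    (sndGk_measurable (ts j)).const_mul _)

set_option maxHeartbeats 1600000 in
lemma snd_main {p q : ℝ} (hp0 : 0 ≤ p) (hp1 : p < 1) (hq0 : 0 < q) (hq3 : q < 3)
    {a : ℝ} (ha : 0 < a) :
    ∃ C : ℝ, 0 < C ∧ ∀ (n : ℕ) (t : ℝ) (ts : Fin n → ℝ) (r : ℝ), a ≤ t → (∀ j, a ≤ ts j) →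
      0 < r → r ≤ 1 → r ≤ a → (∀ j, r ≤ |t - ts j|) → ∀ coef : Fin n → ℝ,
      ENNReal.ofReal (C * r ^ (q + p - 1)) ≤
      ∫⁻ z, ENNReal.ofReal (‖sndGk t z.1 z.2 - ∑ j, (coef j : ℂ) * sndGk (ts j) z.1 z.2‖ ^ 2 *
        (|z.1| ^ (-p) * z.2 ^ (2 - q)))
        ∂((volume : Measure ℝ).prod (volume.restrict (Ioi (0:ℝ)))) := by
  obtain ⟨χ, Y, K, hK, hχc, hχi, hχ0, hχs, -, hχpos, hYc, hYK, hYi, hY⟩ :=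
    snd_bump (a / 4) (a / 4) (by positivity)
  obtain ⟨Ψ, K', hK', hΨc, hΨi, hΨK, hΨ0, hΨ⟩ := snd_psi
  obtain ⟨C, hC, hB⟩ := snd_B hp0 hp1 hq0 hq3 hYc hΨc hYK hΨK
  have hsupp : ∀ s, χ s ≠ 0 → 0 < s ∧ s < a / 2 := by
    intro s hs
    have : |s - a / 4| < a / 4 := by
      by_contra h
      exact hs (hχs s (not_lt.mp h))
    rw [abs_lt] at this
    constructor <;> linarith [this.1, this.2]
  set κ : ℂ := ((∫ s, χ s : ℝ) : ℂ) / 2 * ∫ u in Ioi (0:ℝ), Ψ u with hκ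
  have hκ0 : κ ≠ 0 := by
    rw [hκ]
    refine mul_ne_zero (div_ne_zero ?_ two_ne_zero) hΨ0
    exact_mod_cast hχpos.ne'
  have hκn : 0 < ‖κ‖ := norm_pos_iff.mpr hκ0
  refine ⟨‖κ‖ ^ 2 / C, by positivity, ?_⟩
  intro n t ts r hat hats hr hr1 hra hrt coef
  set F : ℝ → ℝ → ℂ := fun τ ρ => sndGk t τ ρ - ∑ j, (coef j : ℂ) * sndGk (ts j) τ ρ with hF
  have hFm : Measurable (fun z : ℝ × ℝ => F z.1 z.2) := sndF_measurable t ts coef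
  set M : ℝ → ℝ → ℂ := fun τ ρ => sndW Y t τ ρ * (Ψ (r * ρ) * ρ) with hM
  have hMm : Measurable (fun z : ℝ × ℝ => M z.1 z.2) := by
    have h2 : Measurable (fun z : ℝ × ℝ => Ψ (r * z.2) * (z.2 : ℂ)) :=
      (hΨc.measurable.comp (measurable_snd.const_mul r)).mul
        (Complex.measurable_ofReal.comp measurable_snd)
    exact (sndW_measurable hYc t).mul h2
  set μ := (volume : Measure ℝ).prod (volume.restrict (Ioi (0:ℝ))) with hμ
  have hposw : ∀ᵐ z ∂μ, 0 < |z.1| ^ (-p) * z.2 ^ (2 - q) := by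
    have h1 : ∀ᵐ z ∂μ, z.1 ≠ 0 := by
      have : ∀ᵐ τ : ℝ, τ ≠ 0 := by simp [ae_iff, measure_singleton]
      exact Measure.quasiMeasurePreserving_fst.ae this
    have h2 : ∀ᵐ z ∂μ, z.2 ∈ Ioi (0:ℝ) :=
      Measure.quasiMeasurePreserving_snd.ae (ae_restrict_mem measurableSet_Ioi)
    filter_upwards [h1, h2] with z hz1 hz2
    have : 0 < |z.1| := abs_pos.mpr hz1
    have : 0 < z.2 := hz2
    positivity
  have hcs := snd_cs μ (fun z => F z.1 z.2) (fun z => M z.1 z.2)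
    (fun z => |z.1| ^ (-p) * z.2 ^ (2 - q)) hFm hMm (by fun_prop) hposw
  change _ ≤ ∫⁻ z, ENNReal.ofReal (‖F z.1 z.2‖ ^ 2 * (|z.1| ^ (-p) * z.2 ^ (2 - q))) ∂μ
  set A := ∫⁻ z, ENNReal.ofReal (‖F z.1 z.2‖ ^ 2 * (|z.1| ^ (-p) * z.2 ^ (2 - q))) ∂μ with hA
  by_cases hAtop : A = ⊤
  · rw [hAtop]; exact le_top
  have hcs2 := hcs.trans (mul_le_mul_right (hB t r hr hr1) A)
  have hint : Integrable (fun z => F z.1 z.2 * M z.1 z.2) μ := by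
    refine ⟨(hFm.mul hMm).aestronglyMeasurable, ?_⟩
    rw [hasFiniteIntegral_iff_enorm]
    by_contra hcon
    rw [not_lt_top_iff] at hcon
    rw [hcon] at hcs2
    have : A * ENNReal.ofReal (C * r ^ (-1 - q - p)) < ⊤ :=
      ENNReal.mul_lt_top (lt_top_iff_ne_top.mpr hAtop) ENNReal.ofReal_lt_top
    have h3 := hcs2.trans_lt this
    simp at h3
  -- compute the pairing
  have pr : ∀ t' : ℝ, a ≤ t' → ∀ ρ : ℝ, 0 < ρ →
      Integrable (fun τ => sndGk t' τ ρ * sndW Y t τ ρ) ∧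
      ∫ τ, sndGk t' τ ρ * sndW Y t τ ρ =
      ((ρ⁻¹ * ∫ s, χ s * (Real.sin ((t' - s) * ρ) * Real.sin ((t - s) * ρ)) : ℝ) : ℂ) := by
    intro t' ht' ρ hρ
    refine snd_pair hYi hY (by linarith) hρ ?_
    intro s hs
    by_contra h
    obtain ⟨h1, h2⟩ := hsupp s h
    exact hs ⟨h1, by linarith⟩
  set S : ℝ → ℝ → ℝ := fun t' ρ =>
    ∫ s, χ s * (Real.sin ((t' - s) * ρ) * Real.sin ((t - s) * ρ)) with hS
  have hSb : ∀ t', Integrable (fun ρ => Ψ (r * ρ) * ((S t' ρ : ℝ) : ℂ)) (volume.restrict (Ioi 0)) := by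
    intro t'
    have hΨr : Integrable (fun ρ => Ψ (r * ρ)) := hΨi.comp_mul_left' hr.ne'
    refine (hΨr.integrableOn (s := Ioi 0)).mul_bdd (c := ∫ s, χ s) ?_ ?_
    · have hsm : StronglyMeasurable (fun ρ => S t' ρ) := by
        simp only [hS]
        refine StronglyMeasurable.integral_prod_right'
          (f := fun z : ℝ × ℝ => χ z.2 * (Real.sin ((t' - z.2) * z.1) * Real.sin ((t - z.2) * z.1))) ?_
        exact Continuous.stronglyMeasurable (by fun_prop)
      exact (Complex.continuous_ofReal.comp_stronglyMeasurable hsm).aestronglyMeasurable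
    · refine Filter.Eventually.of_forall fun ρ => ?_
      rw [Complex.norm_real]
      simp only [hS]
      refine norm_integral_le_of_norm_le hχi (Filter.Eventually.of_forall fun s => ?_)
      rw [norm_mul, Real.norm_of_nonneg (hχ0 s)]
      refine mul_le_of_le_one_right (hχ0 s) ?_
      rw [Real.norm_eq_abs, abs_mul]
      exact mul_le_one₀ (Real.abs_sin_le_one _) (abs_nonneg _) (Real.abs_sin_le_one _)
  have hhalf : ∀ t' : ℝ, a ≤ t' → ∫ ρ in Ioi (0:ℝ), Ψ (r * ρ) * ((S t' ρ : ℝ) : ℂ) =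
      ((∫ s, χ s : ℝ) : ℂ) / (2 * r) *
        ∫ u in Ioi (0:ℝ), Ψ u * (Real.cos ((t' - t) / r * u) : ℂ) := by
    intro t' ht'
    refine snd_half hΨi hΨ hχi hr ?_
    intro s hs
    obtain ⟨h1, h2⟩ := hsupp s hs
    linarith
  have hP : ∫ z, F z.1 z.2 * M z.1 z.2 ∂μ = κ / r := by
    rw [hμ, integral_prod_symm _ hint]
    have e1 : ∀ ρ ∈ Ioi (0:ℝ), ∫ τ, F τ ρ * M τ ρ =
        Ψ (r * ρ) * ((S t ρ : ℝ) : ℂ) - ∑ j, (coef j : ℂ) * (Ψ (r * ρ) * ((S (ts j) ρ : ℝ) : ℂ)) := by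
      intro ρ hρ
      have hρ0 : 0 < ρ := hρ
      have hρc : (ρ : ℂ) ≠ 0 := by exact_mod_cast hρ0.ne'
      have e2 : ∀ τ, F τ ρ * M τ ρ = (Ψ (r * ρ) * ρ) * (sndGk t τ ρ * sndW Y t τ ρ -
          ∑ j, (coef j : ℂ) * (sndGk (ts j) τ ρ * sndW Y t τ ρ)) := by
        intro τ
        simp only [hF, hM]
        rw [show (∑ j, (coef j : ℂ) * (sndGk (ts j) τ ρ * sndW Y t τ ρ)) =
          (∑ j, (coef j : ℂ) * sndGk (ts j) τ ρ) * sndW Y t τ ρ by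
            rw [Finset.sum_mul]; exact Finset.sum_congr rfl fun j _ => by ring]
        ring
      simp_rw [e2]
      rw [integral_const_mul, integral_sub (pr t hat ρ hρ0).1
        (integrable_finset_sum _ fun j _ => ((pr (ts j) (hats j) ρ hρ0).1.const_mul _)),
        integral_finset_sum _ fun j _ => ((pr (ts j) (hats j) ρ hρ0).1.const_mul _)]
      simp_rw [integral_const_mul]
      rw [(pr t hat ρ hρ0).2]
      rw [Finset.sum_congr rfl fun j _ => by rw [(pr (ts j) (hats j) ρ hρ0).2]]
      rw [mul_sub, Finset.mul_sum]
      congr 1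
      · simp only [hS]; push_cast; field_simp
      · refine Finset.sum_congr rfl fun j _ => ?_
        simp only [hS]; push_cast; field_simp
    rw [setIntegral_congr_fun measurableSet_Ioi e1, integral_sub (hSb t)
      (integrable_finset_sum _ fun j _ => (hSb (ts j)).const_mul _),
      integral_finset_sum _ fun j _ => (hSb (ts j)).const_mul _]
    simp_rw [integral_const_mul]
    rw [Finset.sum_eq_zero, hhalf t hat]
    · simp only [sub_self, zero_div, zero_mul, Real.cos_zero, Complex.ofReal_one, mul_one, sub_zero, hκ]
      have : (r : ℂ) ≠ 0 := by exact_mod_cast hr.ne'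
      field_simp
    · intro j _
      rw [hhalf (ts j) (hats j), hΨ]
      · simp
      · rw [abs_div, abs_of_pos hr, le_div_iff₀ hr, one_mul, abs_sub_comm]
        exact hrt j
  have hfin : ENNReal.ofReal ((‖κ‖ / r) ^ 2) ≤ A * ENNReal.ofReal (C * r ^ (-1 - q - p)) := by
    refine le_trans ?_ hcs2
    rw [ENNReal.ofReal_pow (by positivity)]
    gcongr
    refine le_trans (le_of_eq ?_) (enorm_integral_le_lintegral_enorm _)
    rw [hP, ← ofReal_norm, norm_div, Complex.norm_real, Real.norm_of_nonneg hr.le]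
  rw [← ENNReal.ofReal_toReal hAtop] at hfin ⊢
  rw [← ENNReal.ofReal_mul ENNReal.toReal_nonneg,
    ENNReal.ofReal_le_ofReal_iff (mul_nonneg ENNReal.toReal_nonneg (by positivity))] at hfin
  apply ENNReal.ofReal_le_ofReal
  have e3 : r ^ (-1 - q - p) = (r ^ (q + p - 1))⁻¹ * (r ^ 2)⁻¹ := by
    rw [← Real.rpow_neg hr.le, ← Real.rpow_natCast, ← Real.rpow_neg hr.le, ← Real.rpow_add hr]
    congr 1
    push_cast
    ring
  rw [e3] at hfin
  have hx : 0 < r ^ (q + p - 1) := by positivity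
  set x := r ^ (q + p - 1)
  have h5 : (‖κ‖ / r) ^ 2 * (x * r ^ 2) ≤ A.toReal * (C * (x⁻¹ * (r ^ 2)⁻¹)) * (x * r ^ 2) := by gcongr
  have h6 : ‖κ‖ ^ 2 * x ≤ A.toReal * C := by
    have i1 : (‖κ‖ / r) ^ 2 * (x * r ^ 2) = ‖κ‖ ^ 2 * x := by field_simp
    have i2 : A.toReal * (C * (x⁻¹ * (r ^ 2)⁻¹)) * (x * r ^ 2) = A.toReal * C := by field_simp
    rwa [i1, i2] at h5
  rw [div_mul_eq_mul_div, div_le_iff₀ hC]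
  exact h6



end

/-- Corollary 3.4: strong local nondeterminism in the time variable, with the space
variable held fixed. Here `2α = 2H + 1 − N + β`. -/
theorem strong_LND_time_variable
    (N : ℕ) (hN : 1 ≤ N) (H β : ℝ) (hH1 : 1 / 2 ≤ H) (hH2 : H < 1)
    (hβ0 : 0 < β) (hβN : β < N)
    (hβlow : (N : ℝ) - 2 * H - 1 < β) (hβup : β < (N : ℝ) - 2 * H + 1)
    (hfun : EuclideanSpace ℝ (Fin N) → ℝ) (hmeas : Measurable hfun)
    (c₁ c₂ : ℝ) (hc₁ : 0 < c₁) (hc₁₂ : c₁ ≤ c₂)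
    (hflow : ∀ ξ : EuclideanSpace ℝ (Fin N), ξ ≠ 0 → c₁ * ‖ξ‖ ^ (-β) ≤ hfun ξ)
    (hfup : ∀ ξ : EuclideanSpace ℝ (Fin N), ξ ≠ 0 → hfun ξ ≤ c₂ * ‖ξ‖ ^ (-β))
    (x₀ : EuclideanSpace ℝ (Fin N)) (a : ℝ) (ha : 0 < a) :
    ∃ C r₀ : ℝ, 0 < C ∧ 0 < r₀ ∧
      ∀ n : ℕ, 1 ≤ n →
        ∀ (t : ℝ) (ts : Fin n → ℝ),
          a ≤ t → (∀ j, a ≤ ts j) →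
          (∀ j, |t - ts j| ≤ r₀) →
          ∀ coef : Fin n → ℝ,
            ENNReal.ofReal (C * ⨅ j, |t - ts j| ^ (2 * H + 1 - N + β)) ≤
              specInt N H hfun
                (fun τ ξ => Gker N t x₀ τ ξ - ∑ j, (coef j : ℂ) * Gker N (ts j) x₀ τ ξ) := by
  obtain ⟨C, hC, hmain⟩ := snd_main (p := 2 * H - 1) (q := 3 - N + β) (by linarith) (by linarith)
    (by linarith) (by linarith) ha
  set V := (N : ℝ≥0∞) * volume (Metric.ball (0 : EuclideanSpace ℝ (Fin N)) 1) with hV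
  have hVtop : V ≠ ⊤ := ENNReal.mul_ne_top (ENNReal.natCast_ne_top N) measure_ball_lt_top.ne
  have hV0 : V ≠ 0 := mul_ne_zero (by simp; omega) (Metric.measure_ball_pos _ _ one_pos).ne'
  have hVr : 0 < V.toReal := ENNReal.toReal_pos hV0 hVtop
  refine ⟨V.toReal * c₁ * C, min 1 a, by positivity, by positivity, ?_⟩
  intro n hn t ts hat hats hclose coef
  have hne : Nonempty (Fin n) := ⟨⟨0, hn⟩⟩
  obtain ⟨j₀, hj₀⟩ := Finite.exists_min (fun j => |t - ts j|)
  have hexp : 0 < 2 * H + 1 - N + β := by linarith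
  have hinf : (⨅ j, |t - ts j| ^ (2 * H + 1 - N + β)) ≤ |t - ts j₀| ^ (2 * H + 1 - N + β) :=
    ciInf_le (Set.finite_range _).bddBelow j₀
  refine (ENNReal.ofReal_le_ofReal (mul_le_mul_of_nonneg_left hinf (by positivity))).trans ?_
  set r := |t - ts j₀| with hr
  rcases (abs_nonneg (t - ts j₀)).eq_or_lt with h0 | h0
  · rw [← hr] at h0
    rw [← h0, Real.zero_rpow hexp.ne', mul_zero, ENNReal.ofReal_zero]
    exact zero_le
  · have h1 := hmain n t ts r hat hats h0 ((hclose j₀).trans (min_le_left _ _))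
      ((hclose j₀).trans (min_le_right _ _)) hj₀ coef
    have h2 := snd_A N hN H β hfun c₁ hc₁ hflow
      (fun τ ρ => sndGk t τ ρ - ∑ j, (coef j : ℂ) * sndGk (ts j) τ ρ) (sndF_measurable t ts coef)
      (fun τ ξ => Gker N t x₀ τ ξ - ∑ j, (coef j : ℂ) * Gker N (ts j) x₀ τ ξ) (by
        intro τ ξ
        simp only [Gker_eq]
        rw [show (∑ j, (coef j : ℂ) * (Complex.exp (-Complex.I * ((inner ℝ x₀ ξ : ℝ) : ℂ)) *
            sndGk (ts j) τ ‖ξ‖)) = Complex.exp (-Complex.I * ((inner ℝ x₀ ξ : ℝ) : ℂ)) *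
            ∑ j, (coef j : ℂ) * sndGk (ts j) τ ‖ξ‖ by
              rw [Finset.mul_sum]; exact Finset.sum_congr rfl fun j _ => by ring,
          ← mul_sub, norm_mul]
        have : ‖Complex.exp (-Complex.I * ((inner ℝ x₀ ξ : ℝ) : ℂ))‖ = 1 := by
          rw [Complex.norm_exp]; simp
        rw [this, one_mul])
    refine le_trans ?_ h2
    rw [mul_assoc (V.toReal * c₁), ENNReal.ofReal_mul (by positivity),
      ENNReal.ofReal_mul hVr.le, ENNReal.ofReal_toReal hVtop]
    refine mul_le_mul_right ?_ _
    rw [show 2 * H + 1 - N + β = (3 - N + β) + (2 * H - 1) - 1 by ring]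
    refine h1.trans (le_of_eq ?_)
    rw [show -(2 * H - 1) = 1 - 2 * H by ring, show 2 - (3 - N + β) = (N : ℝ) - 1 - β by ring]
end

section
/- (Linear independence.) Let n ≥ 2 and let (t¹, x¹), …, (tⁿ, xⁿ) be distinct points in (0, ∞) × ℝ^N. If a₁, …, aₙ are real numbers such that Σ_{j=1}^n a_j 𝒢_{t^j,x^j}(τ, ξ) = 0 for all ξ ∈ ℝ^N ∖ {0} and all τ ∈ ℝ with τ ∉ {|ξ|, −|ξ|}, then a₁ = a₂ = ⋯ = aₙ = 0. (Equivalently, the Gaussian random variables u₁(t¹, x¹), …, u₁(tⁿ, xⁿ) are linearly independent.) -/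
open MeasureTheory Set
open scoped ENNReal

/-- The character `(τ, ξ) ↦ exp(-i (t τ + ⟨x, ξ⟩))`. -/
noncomputable def waveChar (N : ℕ) (t : ℝ) (x : EuclideanSpace ℝ (Fin N)) :
    Multiplicative (ℝ × EuclideanSpace ℝ (Fin N)) →* ℂ where
  toFun p := Complex.exp (-Complex.I * ((t * p.toAdd.1 + inner ℝ x p.toAdd.2 : ℝ) : ℂ))
  map_one' := by simp
  map_mul' p q := by
    rw [← Complex.exp_add]
    congr 1
    simp only [toAdd_mul, Prod.fst_add, Prod.snd_add, inner_add_right]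
    push_cast
    ring

theorem waveChar_injective (N : ℕ) (t s : ℝ) (x y : EuclideanSpace ℝ (Fin N))
    (h : waveChar N t x = waveChar N s y) : (t, x) = (s, y) := by
  by_contra hne
  have hD : 0 < (t - s) ^ 2 + ‖x - y‖ ^ 2 := by
    by_cases hts : t = s
    · have hxy : x - y ≠ 0 := by
        intro hxy
        exact hne (by rw [hts, sub_eq_zero.mp hxy])
      have := norm_pos_iff.mpr hxy
      positivity
    · have : t - s ≠ 0 := sub_ne_zero.mpr hts
      positivity
  set D := (t - s) ^ 2 + ‖x - y‖ ^ 2 with hDdef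
  have h1 := DFunLike.congr_fun h
    (Multiplicative.ofAdd ((Real.pi / D) * (t - s), (Real.pi / D) • (x - y)))
  simp only [waveChar, MonoidHom.coe_mk, OneHom.coe_mk, toAdd_ofAdd] at h1
  have key : t * ((Real.pi / D) * (t - s)) + inner ℝ x ((Real.pi / D) • (x - y))
      = s * ((Real.pi / D) * (t - s)) + inner ℝ y ((Real.pi / D) • (x - y)) + Real.pi := by
    have e1 : inner ℝ x ((Real.pi / D) • (x - y)) - inner ℝ y ((Real.pi / D) • (x - y))
        = (Real.pi / D) * ‖x - y‖ ^ 2 := by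
      rw [← inner_sub_left, inner_smul_right, real_inner_self_eq_norm_sq]
    have e2 : (Real.pi / D) * D = Real.pi := by field_simp
    have e3 : (Real.pi / D) * D = (Real.pi / D) * ((t - s) ^ 2 + ‖x - y‖ ^ 2) := by rw [hDdef]
    linarith
  rw [key] at h1
  generalize s * ((Real.pi / D) * (t - s)) + inner ℝ y ((Real.pi / D) • (x - y)) = A at h1
  have h2 : Complex.exp (-Complex.I * ((A + Real.pi : ℝ) : ℂ))
      = - Complex.exp (-Complex.I * (A : ℂ)) := by
    have : -Complex.I * ((A + Real.pi : ℝ) : ℂ)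
        = -Complex.I * (A : ℂ) - Real.pi * Complex.I := by push_cast; ring
    rw [this, Complex.exp_sub, Complex.exp_pi_mul_I]
    ring
  rw [h2] at h1
  have h3 := Complex.exp_ne_zero (-Complex.I * (A : ℂ))
  apply h3
  linear_combination (-1/2 : ℂ) * h1

theorem Gker_mul (N : ℕ) (t : ℝ) (x : EuclideanSpace ℝ (Fin N)) (τ : ℝ)
    (ξ : EuclideanSpace ℝ (Fin N)) (hξ : ξ ≠ 0) (h1 : τ ≠ ‖ξ‖) (h2 : τ ≠ -‖ξ‖) :
    2 * (‖ξ‖ : ℂ) * ((τ : ℂ) + ‖ξ‖) * ((τ : ℂ) - ‖ξ‖) * Gker N t x τ ξ =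
      Complex.exp (-Complex.I * ((inner ℝ x ξ : ℝ) : ℂ)) *
        (-2 * ‖ξ‖ * Complex.exp (-Complex.I * (t : ℂ) * (τ : ℂ))
          - τ * (Complex.exp (Complex.I * (t : ℂ) * (‖ξ‖ : ℂ))
            - Complex.exp (-Complex.I * (t : ℂ) * (‖ξ‖ : ℂ)))
          + ‖ξ‖ * (Complex.exp (Complex.I * (t : ℂ) * (‖ξ‖ : ℂ))
            + Complex.exp (-Complex.I * (t : ℂ) * (‖ξ‖ : ℂ)))) := by
  have a0 : (‖ξ‖ : ℂ) ≠ 0 := by exact_mod_cast (norm_ne_zero_iff.mpr hξ)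
  have a1 : (τ : ℂ) - ‖ξ‖ ≠ 0 := by
    rw [sub_ne_zero]; exact_mod_cast h1
  have a2 : (τ : ℂ) + ‖ξ‖ ≠ 0 := by
    intro h
    apply h2
    have : τ + ‖ξ‖ = 0 := by exact_mod_cast h
    linarith
  unfold Gker
  generalize Complex.exp (-Complex.I * ((inner ℝ x ξ : ℝ) : ℂ)) = A
  generalize Complex.exp (-Complex.I * (t : ℂ) * (τ : ℂ)) = B
  generalize Complex.exp (-Complex.I * (t : ℂ) * (‖ξ‖ : ℂ)) = C
  generalize Complex.exp (Complex.I * (t : ℂ) * (‖ξ‖ : ℂ)) = D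
  generalize (‖ξ‖ : ℂ) = r at *
  generalize (τ : ℂ) = w at *
  field_simp
  ring

/-- Proposition 3.6: for distinct points `(t¹,x¹), …, (tⁿ,xⁿ)` in `(0,∞) × ℝ^N`, if a real
linear combination of the kernels `𝒢_{t^j,x^j}` vanishes identically, then all the
coefficients vanish.  (Equivalently, the Gaussian random variables
`u₁(t¹,x¹), …, u₁(tⁿ,xⁿ)` are linearly independent.) -/
theorem Gker_linear_independence
    (N : ℕ) (hN : 1 ≤ N) (n : ℕ) (hn : 2 ≤ n)
    (ts : Fin n → ℝ) (xs : Fin n → EuclideanSpace ℝ (Fin N))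
    (hpos : ∀ j, 0 < ts j)
    (hdist : ∀ i j : Fin n, i ≠ j → (ts i, xs i) ≠ (ts j, xs j))
    (coef : Fin n → ℝ)
    (hzero : ∀ ξ : EuclideanSpace ℝ (Fin N), ξ ≠ 0 →
      ∀ τ : ℝ, τ ≠ ‖ξ‖ → τ ≠ -‖ξ‖ →
        ∑ j, (coef j : ℂ) * Gker N (ts j) (xs j) τ ξ = 0) :
    ∀ j, coef j = 0 := by
  -- the polynomial identity, for all `τ`
  have hF : ∀ ξ : EuclideanSpace ℝ (Fin N), ξ ≠ 0 → ∀ τ : ℝ,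
      ∑ j, (coef j : ℂ) * (Complex.exp (-Complex.I * ((inner ℝ (xs j) ξ : ℝ) : ℂ)) *
        (-2 * ‖ξ‖ * Complex.exp (-Complex.I * (ts j : ℂ) * (τ : ℂ))
          - τ * (Complex.exp (Complex.I * (ts j : ℂ) * (‖ξ‖ : ℂ))
            - Complex.exp (-Complex.I * (ts j : ℂ) * (‖ξ‖ : ℂ)))
          + ‖ξ‖ * (Complex.exp (Complex.I * (ts j : ℂ) * (‖ξ‖ : ℂ))
            + Complex.exp (-Complex.I * (ts j : ℂ) * (‖ξ‖ : ℂ))))) = 0 := by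
    intro ξ hξ
    have hd : Dense (({‖ξ‖, -‖ξ‖} : Set ℝ)ᶜ) :=
      (Set.toFinite ({‖ξ‖, -‖ξ‖} : Set ℝ)).countable.dense_compl ℝ
    refine funext_iff.mp (Continuous.ext_on hd ?_ continuous_const ?_)
    · fun_prop
    · intro σ hσ
      simp only [Set.mem_compl_iff, Set.mem_insert_iff, Set.mem_singleton_iff, not_or] at hσ
      have := hzero ξ hξ σ hσ.1 hσ.2
      have h2 := congrArg
        (fun z => 2 * (‖ξ‖ : ℂ) * ((σ : ℂ) + ‖ξ‖) * ((σ : ℂ) - ‖ξ‖) * z) this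
      simp only [Finset.mul_sum, mul_zero] at h2
      rw [← h2]
      refine Finset.sum_congr rfl fun j _ => ?_
      rw [← Gker_mul N (ts j) (xs j) σ ξ hξ hσ.1 hσ.2]
      ring
  set S : ℝ := ∑ i, ts i with hS
  have hle : ∀ j, ts j ≤ S := fun j =>
    Finset.single_le_sum (fun i _ => (hpos i).le) (Finset.mem_univ j)
  set h : ℝ := Real.pi / S with hh
  -- second difference
  have hG : ∀ ξ : EuclideanSpace ℝ (Fin N), ξ ≠ 0 → ∀ τ : ℝ,
      ∑ j, ((coef j : ℂ) * (Complex.exp (-Complex.I * ((ts j * h : ℝ) : ℂ)) - 1) ^ 2) *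
        Complex.exp (-Complex.I * ((ts j * τ + inner ℝ (xs j) ξ : ℝ) : ℂ)) = 0 := by
    intro ξ hξ τ
    have a0 : (‖ξ‖ : ℂ) ≠ 0 := by exact_mod_cast (norm_ne_zero_iff.mpr hξ)
    have e0 := hF ξ hξ τ
    have e1 := hF ξ hξ (τ + h)
    have e2 := hF ξ hξ (τ + h + h)
    have a1 : (-2 * (‖ξ‖ : ℂ)) ≠ 0 := mul_ne_zero (by norm_num) a0
    apply mul_left_cancel₀ a1
    rw [mul_zero]
    have e3 := congrArg₂ (· + ·) (congrArg₂ (· - ·) e2 (congrArg (fun z => 2 * z) e1)) e0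
    simp only [Finset.mul_sum, ← Finset.sum_sub_distrib, ← Finset.sum_add_distrib] at e3
    rw [Finset.mul_sum]
    refine Eq.trans (Finset.sum_congr rfl fun j _ => ?_) (e3.trans (by ring))
    have b0 : Complex.exp (-Complex.I * ((ts j * τ + inner ℝ (xs j) ξ : ℝ) : ℂ))
        = Complex.exp (-Complex.I * ((inner ℝ (xs j) ξ : ℝ) : ℂ)) *
          Complex.exp (-Complex.I * (ts j : ℂ) * (τ : ℂ)) := by
      rw [← Complex.exp_add]; congr 1; push_cast; ring
    have b1 : ∀ σ : ℝ, Complex.exp (-Complex.I * (ts j : ℂ) * ((σ + h : ℝ) : ℂ))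
        = Complex.exp (-Complex.I * (ts j : ℂ) * (σ : ℂ)) *
          Complex.exp (-Complex.I * ((ts j * h : ℝ) : ℂ)) := by
      intro σ
      rw [← Complex.exp_add]; congr 1; push_cast; ring
    rw [b0, b1, b1]
    push_cast
    ring
  have hG0 : ∀ ξ : EuclideanSpace ℝ (Fin N), ∀ τ : ℝ,
      ∑ j, ((coef j : ℂ) * (Complex.exp (-Complex.I * ((ts j * h : ℝ) : ℂ)) - 1) ^ 2) *
        Complex.exp (-Complex.I * ((ts j * τ + inner ℝ (xs j) ξ : ℝ) : ℂ)) = 0 := by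
    intro ξ τ
    revert ξ
    have : Nonempty (Fin N) := ⟨⟨0, hN⟩⟩
    have : Nontrivial (EuclideanSpace ℝ (Fin N)) := inferInstance
    have : (nhdsWithin (0 : EuclideanSpace ℝ (Fin N)) {0}ᶜ).NeBot :=
      Module.punctured_nhds_neBot ℝ _ 0
    have hd : Dense (({0} : Set (EuclideanSpace ℝ (Fin N)))ᶜ) := dense_compl_singleton 0
    refine funext_iff.mp (Continuous.ext_on hd ?_ continuous_const ?_)
    · fun_prop
    · intro η hη
      exact hG η hη τ
  have hinj : Function.Injective (fun j => waveChar N (ts j) (xs j)) := by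
    intro i j hij
    by_contra hne
    exact hdist i j hne (waveChar_injective N _ _ _ _ hij)
  have hli := (linearIndependent_monoidHom
    (Multiplicative (ℝ × EuclideanSpace ℝ (Fin N))) ℂ).comp _ hinj
  rw [Fintype.linearIndependent_iff] at hli
  intro j
  have hj := hli (fun j => (coef j : ℂ) *
    (Complex.exp (-Complex.I * ((ts j * h : ℝ) : ℂ)) - 1) ^ 2) (by
      funext p
      simpa [waveChar] using hG0 p.toAdd.2 p.toAdd.1) j
  rcases mul_eq_zero.mp hj with h0 | h0
  · exact_mod_cast h0
  · exfalso
    have h1 := sub_eq_zero.mp (pow_eq_zero_iff (two_ne_zero)|>.mp h0)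
    have hSpos : 0 < S := (hpos j).trans_le (hle j)
    have c1 : 0 < ts j * h := mul_pos (hpos j) (div_pos Real.pi_pos hSpos)
    have c2 : ts j * h ≤ Real.pi := by
      have : S * h = Real.pi := by rw [hh]; field_simp
      rw [← this]
      exact mul_le_mul_of_nonneg_right (hle j) (div_pos Real.pi_pos hSpos).le
    have h2 := congrArg Complex.re h1
    have h3 : Real.cos (ts j * h) = 1 := by
      have : -Complex.I * ((ts j * h : ℝ) : ℂ) = ((-(ts j * h) : ℝ) : ℂ) * Complex.I := by
        push_cast; ring
      rw [this, Complex.exp_ofReal_mul_I_re, Real.cos_neg] at h2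
      simpa using h2
    have := (Real.cos_eq_one_iff_of_lt_of_lt (by linarith [Real.pi_pos])
      (by linarith [Real.pi_pos])).mp h3
    linarith
end

section
/- (Directional lower bound, the key step of the spherical LND.) For every a > 0 there exists a constant C > 0 such that for every unit vector w ∈ S^{N−1}, every integer n ≥ 1, all points (t, x), (t¹, x¹), …, (tⁿ, xⁿ) ∈ [a, ∞) × ℝ^N with max_{1≤j≤n}(|t − t^j| + |x − x^j|) ≤ a/2, and all real numbers a₁, …, aₙ, one has ∫_ℝ ∫_ℝ |F(t, ⟨x, w⟩, τ, ρ) − Σ_{j=1}^n a_j F(t^j, ⟨x^j, w⟩, τ, ρ)|² |τ|^{1−2H} |ρ|^{N−β−3} dτ dρ ≥ C · (min_{1≤j≤n} |(t − t^j) + ⟨x − x^j, w⟩|)^{2H+1−N+β}, where C does not depend on w, n, the points, or the coefficients. -/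
open MeasureTheory Set
open scoped ENNReal

/-- The function `F(t, y, τ, ρ)` appearing in the spherical-coordinate form of the
spectral representation: for `ξ ≠ 0` and `w = ξ/|ξ|` one has
`𝒢_{t,x}(τ, ξ) = |ξ|⁻¹ F(t, ⟨x,w⟩, τ, |ξ|)`. -/
noncomputable def Fker (t y τ ρ : ℝ) : ℂ :=
  (Complex.exp (-Complex.I * (ρ : ℂ) * (y : ℂ)) / 2) *
    ((Complex.exp (-Complex.I * (t : ℂ) * (τ : ℂ)) -
        Complex.exp (Complex.I * (t : ℂ) * (ρ : ℂ))) / ((τ : ℂ) + (ρ : ℂ)) -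
      (Complex.exp (-Complex.I * (t : ℂ) * (τ : ℂ)) -
        Complex.exp (-Complex.I * (t : ℂ) * (ρ : ℂ))) / ((τ : ℂ) - (ρ : ℂ)))


noncomputable def ex (u : ℝ) : ℂ := Complex.exp (Complex.I * (u : ℂ))

lemma ex_add (u v : ℝ) : ex (u + v) = ex u * ex v := by
  unfold ex; rw [← Complex.exp_add]; congr 1; push_cast; ring

lemma ex_norm (u : ℝ) : ‖ex u‖ = 1 := by
  unfold ex; rw [mul_comm]; exact Complex.norm_exp_ofReal_mul_I u

lemma ex_cont : Continuous ex := by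
  unfold ex; fun_prop

lemma ex_cont' {X : Type*} [TopologicalSpace X] {f : X → ℝ} (hf : Continuous f) :
    Continuous (fun x => ex (f x)) := ex_cont.comp hf

lemma fub (g : ℝ → ℂ) (hg : Continuous g) (P : ℝ → ℂ) (hP : Integrable P) (v k t : ℝ)
    (ht : 0 ≤ t) :
    Integrable (fun τ => (∫ s in (0 : ℝ)..t, ex ((v + k * s) * τ) * g s) * P τ) ∧
    ∫ τ, (∫ s in (0 : ℝ)..t, ex ((v + k * s) * τ) * g s) * P τ =
      ∫ s in (0 : ℝ)..t, g s * ∫ τ, ex ((v + k * s) * τ) * P τ := by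
  have hgi : Integrable g (volume.restrict (Ioc 0 t)) :=
    (hg.integrableOn_Icc (a := 0) (b := t)).mono_set Ioc_subset_Icc_self
  have h1 : Integrable (Function.uncurry fun τ s => ex ((v + k * s) * τ) * (P τ * g s))
      (volume.prod (volume.restrict (Ioc 0 t))) := by
    refine Integrable.bdd_mul (c := 1) (hP.mul_prod hgi) ?_ ?_
    · exact (ex_cont' (by fun_prop)).aestronglyMeasurable
    · exact Filter.Eventually.of_forall fun x => (ex_norm _).le
  have e1 : (fun τ => (∫ s in (0 : ℝ)..t, ex ((v + k * s) * τ) * g s) * P τ) =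
      fun τ => ∫ s in Ioc 0 t, ex ((v + k * s) * τ) * (P τ * g s) := by
    funext τ
    rw [intervalIntegral.integral_of_le ht, ← integral_mul_const]
    congr 1; funext s; ring
  rw [e1]
  refine ⟨h1.integral_prod_left, ?_⟩
  rw [integral_integral_swap h1, intervalIntegral.integral_of_le ht]
  congr 1; funext s
  rw [← integral_const_mul]
  congr 1; funext τ; ring

lemma Fker_eq (t y τ ρ : ℝ) (h1 : τ ≠ ρ) (h2 : τ ≠ -ρ) :
    Fker t y τ ρ = ex (-(ρ * y)) *
      ∫ s in (0 : ℝ)..t, ex ((0 + (-1) * s) * τ) * (Real.sin ((t - s) * ρ) : ℂ) := by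
  have hc1 : (τ : ℂ) + ρ ≠ 0 := by
    intro h; apply h2; have : τ + ρ = 0 := by exact_mod_cast h
    linarith
  have hc2 : (τ : ℂ) - ρ ≠ 0 := by
    intro h; apply h1; have : τ - ρ = 0 := by exact_mod_cast h
    linarith
  have e1 : ∀ s : ℝ, ex ((0 + (-1) * s) * τ) * (Real.sin ((t - s) * ρ) : ℂ) =
      (Complex.exp (Complex.I * t * ρ) / (2 * Complex.I)) *
        Complex.exp ((-Complex.I * (τ + ρ)) * s) -
      (Complex.exp (-Complex.I * t * ρ) / (2 * Complex.I)) *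
        Complex.exp ((-Complex.I * (τ - ρ)) * s) := by
    intro s
    rw [Complex.ofReal_sin, Complex.sin]
    rw [div_mul_eq_mul_div, div_mul_eq_mul_div, ← Complex.exp_add, ← Complex.exp_add, ← sub_div]
    unfold ex
    rw [mul_div_assoc', ← mul_assoc, mul_sub, ← Complex.exp_add, ← Complex.exp_add]
    push_cast
    rw [div_eq_div_iff (by norm_num) (by simp)]
    have i2 := Complex.I_sq
    have a1 : Complex.I * ((0 + -1 * (s : ℂ)) * τ) + -((t - s) * ρ) * Complex.I =
      -Complex.I * t * ρ + -Complex.I * (τ - ρ) * s := by ring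
    have a2 : Complex.I * ((0 + -1 * (s : ℂ)) * τ) + ((t - s) * ρ) * Complex.I =
      Complex.I * t * ρ + -Complex.I * (τ + ρ) * s := by ring
    rw [a1, a2]
    linear_combination 2 * (Complex.exp (-Complex.I * t * ρ + -Complex.I * (τ - ρ) * s) - Complex.exp (Complex.I * t * ρ + -Complex.I * (τ + ρ) * s)) * i2
  simp_rw [e1]
  have hd1 : -Complex.I * ((τ : ℂ) + ρ) ≠ 0 := mul_ne_zero (neg_ne_zero.2 Complex.I_ne_zero) hc1
  have hd2 : -Complex.I * ((τ : ℂ) - ρ) ≠ 0 := mul_ne_zero (neg_ne_zero.2 Complex.I_ne_zero) hc2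
  rw [intervalIntegral.integral_sub, intervalIntegral.integral_const_mul,
    intervalIntegral.integral_const_mul, integral_exp_mul_complex hd1, integral_exp_mul_complex hd2]
  rotate_left
  · exact Continuous.intervalIntegrable (by fun_prop) _ _
  · exact Continuous.intervalIntegrable (by fun_prop) _ _
  unfold Fker ex
  have b0 : Complex.exp (Complex.I * ((-(ρ * y) : ℝ) : ℂ)) = Complex.exp (-Complex.I * ρ * y) := by
    congr 1; push_cast; ring
  have b1 : Complex.exp (-Complex.I * (τ + ρ) * t) =
      Complex.exp (-Complex.I * t * τ) * Complex.exp (-Complex.I * t * ρ) := by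
    rw [← Complex.exp_add]; congr 1; ring
  have b2 : Complex.exp (-Complex.I * (τ - ρ) * t) =
      Complex.exp (-Complex.I * t * τ) * Complex.exp (Complex.I * t * ρ) := by
    rw [← Complex.exp_add]; congr 1; ring
  have b3 : Complex.exp (Complex.I * t * ρ) * Complex.exp (-Complex.I * t * ρ) = 1 := by
    rw [← Complex.exp_add]; simp
  rw [b0, b1, b2]
  simp only [Complex.ofReal_zero, mul_zero, Complex.exp_zero]
  generalize Complex.exp (-Complex.I * ρ * y) = Y
  generalize Complex.exp (-Complex.I * t * τ) = T at *
  generalize Complex.exp (Complex.I * t * ρ) = R at *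
  generalize Complex.exp (-Complex.I * t * ρ) = S at *
  have i2 := Complex.I_sq
  have hI := Complex.I_ne_zero
  have c1 : ∀ z w : ℂ, z ≠ 0 → R / (2 * Complex.I) * ((T * S - 1) / (-Complex.I * z)) =
      (T - R) / z / 2 := by
    intro z w hz
    field_simp
    linear_combination (-T) * b3 - (T - R) * i2
  have c2 : ∀ z w : ℂ, z ≠ 0 → S / (2 * Complex.I) * ((T * R - 1) / (-Complex.I * z)) =
      (T - S) / z / 2 := by
    intro z w hz
    field_simp
    linear_combination (-T) * b3 - (T - S) * i2
  rw [c1 _ 0 hc1, c2 _ 0 hc2]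
  ring

lemma exists_test (m R : ℝ) (hR : 0 < R) : ∃ (p : ℝ → ℂ) (φ : ℝ → ℝ),
    Continuous p ∧ Integrable p ∧ Continuous φ ∧ (∀ s, 0 ≤ φ s) ∧ φ m = 1 ∧
    (∀ s, R ≤ |s - m| → φ s = 0) ∧
    (∀ s, ∫ σ, ex (-(s * σ)) * p σ = (φ s : ℂ)) ∧
    (∀ e : ℝ, 0 ≤ e → ∫⁻ σ, ENNReal.ofReal (‖p σ‖ ^ 2 * |σ| ^ e) < ⊤) := by
  let f : ContDiffBump m := ⟨R / 2, R, by positivity, by linarith⟩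
  have hcs : HasCompactSupport (fun x : ℝ => ((f x : ℝ) : ℂ)) :=
    f.hasCompactSupport.comp_left (g := fun x : ℝ => (x : ℂ)) (by simp)
  let φ : SchwartzMap ℝ ℂ := hcs.toSchwartzMap (Complex.ofRealCLM.contDiff.comp f.contDiff)
  have hφ : ∀ x, φ x = ((f x : ℝ) : ℂ) := fun x => rfl
  let P : SchwartzMap ℝ ℂ := FourierTransformInv.fourierInv φ
  have hPφ : FourierTransform.fourier P = φ := FourierTransform.fourier_fourierInv_eq φ
  have pi2 : (2 * Real.pi) ≠ 0 := by positivity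
  refine ⟨fun σ => (1 / (2 * Real.pi) : ℝ) * P (σ / (2 * Real.pi)), fun x => f x, ?_, ?_,
    f.continuous, fun s => f.nonneg, ?_, ?_, ?_, ?_⟩
  · have := P.continuous
    fun_prop
  · exact ((P.integrable (μ := volume)).comp_div pi2).const_mul _
  · exact f.one_of_mem_closedBall (by simp [f.rIn_pos.le])
  · intro s hs
    exact f.zero_of_le_dist (by simpa [Real.dist_eq] using hs)
  · intro s
    have h := congrArg (fun g : SchwartzMap ℝ ℂ => g s) hPφ
    simp only [hφ] at h
    rw [← h, SchwartzMap.fourier_coe, Real.fourier_real_eq_integral_exp_smul]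
    have := Measure.integral_comp_div (fun u : ℝ => Complex.exp (((-2 * Real.pi * u * s : ℝ) : ℂ) * Complex.I) • P u) (2 * Real.pi)
    have h2 : |2 * Real.pi| = 2 * Real.pi := abs_of_pos (by positivity)
    rw [h2] at this
    calc _ = ∫ σ : ℝ, ((1 / (2 * Real.pi) : ℝ) : ℂ) * (Complex.exp (((-2 * Real.pi * (σ / (2 * Real.pi)) * s : ℝ) : ℂ) * Complex.I) • P (σ / (2 * Real.pi))) := by
          congr 1; funext σ
          have : -2 * Real.pi * (σ / (2 * Real.pi)) * s = -(s * σ) := by field_simp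
          rw [this, ex, smul_eq_mul, mul_comm Complex.I]; ring
      _ = _ := by
          rw [integral_const_mul, this, Complex.real_smul, ← mul_assoc, ← Complex.ofReal_mul]
          rw [one_div_mul_cancel pi2]; simp
  · intro e he
    obtain ⟨k, hk⟩ := exists_nat_ge e
    obtain ⟨B, hB⟩ : ∃ B, ∀ x, ‖P x‖ ≤ B := ⟨_, fun x => P.norm_le_seminorm ℝ x⟩
    have hB0 : 0 ≤ B := (norm_nonneg _).trans (hB 0)
    have i1 := ((P.integrable (μ := volume)).comp_div pi2).norm
    have i2 := (P.integrable_pow_mul volume k).comp_div pi2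
    have i3 := (i1.const_mul ((1 / (2 * Real.pi)) ^ 2 * B)).add (i2.const_mul ((1 / (2 * Real.pi)) ^ 2 * B * (2 * Real.pi) ^ k))
    refine lt_of_le_of_lt (lintegral_mono fun σ => ENNReal.ofReal_le_ofReal ?_) i3.lintegral_lt_top
    have hpow : |σ| ^ e ≤ 1 + |σ| ^ k := by
      rcases le_total |σ| 1 with h | h
      · have := Real.rpow_le_one (abs_nonneg σ) h he
        have : 0 ≤ |σ| ^ k := by positivity
        linarith
      · have := Real.rpow_le_rpow_of_exponent_le h hk
        rw [Real.rpow_natCast] at this; linarith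
    simp only [Pi.add_apply, norm_mul, Complex.norm_real, Real.norm_eq_abs, abs_div, abs_one, abs_mul]
    have h2 : |2 * Real.pi| = 2 * Real.pi := abs_of_pos (by positivity)
    rw [← abs_mul, h2, div_pow]
    generalize hv : ‖P (σ / (2 * Real.pi))‖ = V
    have hV0 : 0 ≤ V := hv ▸ norm_nonneg _
    have hVB : V ≤ B := hv ▸ hB _
    have : V ^ 2 * |σ| ^ e ≤ B * V * (1 + |σ| ^ k) := by
      rw [pow_two]; gcongr
    calc (1 / (2 * Real.pi) * V) ^ 2 * |σ| ^ e = (1 / (2 * Real.pi)) ^ 2 * (V ^ 2 * |σ| ^ e) := by ring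
      _ ≤ (1 / (2 * Real.pi)) ^ 2 * (B * V * (1 + |σ| ^ k)) := by gcongr
      _ = _ := by
        have h3 : (2 * Real.pi) ^ k * (|σ| / (2 * Real.pi)) ^ k = |σ| ^ k := by
          rw [← mul_pow, mul_div_cancel₀ _ pi2]
        rw [← h3]; field_simp

lemma sin_ex (θ : ℝ) : (Real.sin θ : ℂ) = (ex θ - ex (-θ)) / (2 * Complex.I) := by
  rw [Complex.ofReal_sin, Complex.sin, ex, ex, eq_div_iff (by simp)]
  push_cast
  have a1 : -(θ : ℂ) * Complex.I = Complex.I * -θ := by ring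
  rw [a1, mul_comm (θ : ℂ)]
  linear_combination (Complex.exp (Complex.I * -θ) - Complex.exp (Complex.I * θ)) * Complex.I_sq

lemma inner_int (p : ℝ → ℂ) (φ : ℝ → ℝ) (hp : Integrable p)
    (hpφ : ∀ s, ∫ σ, ex (-(s * σ)) * p σ = (φ s : ℂ)) (t y ρ : ℝ) (ht : 0 ≤ t) :
    Integrable (fun τ => Fker t y τ ρ * p (τ - ρ)) ∧
    ∫ τ, Fker t y τ ρ * p (τ - ρ) = ex (-(ρ * y)) *
      ∫ s in (0 : ℝ)..t, (Real.sin ((t - s) * ρ) : ℂ) * (ex (-(s * ρ)) * φ s) := by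
  have hae : (fun τ => Fker t y τ ρ * p (τ - ρ)) =ᵐ[volume] fun τ => ex (-(ρ * y)) *
      ((∫ s in (0 : ℝ)..t, ex ((0 + (-1) * s) * τ) * (Real.sin ((t - s) * ρ) : ℂ)) * p (τ - ρ)) := by
    have h1 : ∀ᵐ τ : ℝ, τ ≠ ρ := Measure.ae_ne volume ρ
    have h2 : ∀ᵐ τ : ℝ, τ ≠ -ρ := Measure.ae_ne volume (-ρ)
    filter_upwards [h1, h2] with τ h1 h2
    rw [Fker_eq t y τ ρ h1 h2, mul_assoc]
  obtain ⟨f1, f2⟩ := fub (fun s => (Real.sin ((t - s) * ρ) : ℂ)) (by fun_prop)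
    (fun τ => p (τ - ρ)) (hp.comp_sub_right ρ) 0 (-1) t ht
  refine ⟨(integrable_congr hae).2 (f1.const_mul _), ?_⟩
  rw [integral_congr_ae hae, integral_const_mul, f2]
  congr 1
  congr 1; funext s
  congr 1
  rw [← hpφ s, ← integral_const_mul,
    ← integral_sub_right_eq_self (fun σ => ex (-(s * ρ)) * (ex (-(s * σ)) * p σ)) ρ]
  congr 1; funext τ
  rw [← mul_assoc, ← ex_add]
  congr 2; ring

lemma scale_int (q : ℝ → ℂ) (ψ : ℝ → ℝ)
    (hqψ : ∀ s, ∫ σ, ex (-(s * σ)) * q σ = (ψ s : ℂ)) (r : ℝ) (hr : 0 < r) (u : ℝ) :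
    ∫ ρ, ex (u * ρ) * (r * q (r * ρ)) = (ψ (-u / r) : ℂ) := by
  have h := Measure.integral_comp_mul_left (fun x : ℝ => ex (-((-u / r) * x)) * q x) r
  rw [hqψ, abs_of_pos (inv_pos.2 hr), Complex.real_smul] at h
  have hr' : (r : ℂ) ≠ 0 := by exact_mod_cast hr.ne'
  have : (ψ (-u / r) : ℂ) = r * ∫ x : ℝ, ex (-((-u / r) * (r * x))) * q (r * x) := by
    rw [h]; push_cast; field_simp
  rw [this, ← integral_const_mul]
  congr 1; funext x
  have : -((-u / r) * (r * x)) = u * x := by field_simp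
  rw [this]; ring

lemma outer_int (φ : ℝ → ℝ) (hφ : Continuous φ) (q : ℝ → ℂ) (ψ : ℝ → ℝ) (hq : Integrable q)
    (hqψ : ∀ s, ∫ σ, ex (-(s * σ)) * q σ = (ψ s : ℂ)) (r : ℝ) (hr : 0 < r)
    (t y c : ℝ) (ht : 0 ≤ t) :
    Integrable (fun ρ => (ex (-(ρ * y)) *
      ∫ s in (0 : ℝ)..t, (Real.sin ((t - s) * ρ) : ℂ) * (ex (-(s * ρ)) * φ s)) *
        (ex (c * ρ) * (r * q (r * ρ)))) ∧
    ∫ ρ, (ex (-(ρ * y)) *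
      ∫ s in (0 : ℝ)..t, (Real.sin ((t - s) * ρ) : ℂ) * (ex (-(s * ρ)) * φ s)) *
        (ex (c * ρ) * (r * q (r * ρ))) =
      (1 / (2 * Complex.I)) * ((∫ s in (0 : ℝ)..t, (φ s : ℂ) * (ψ ((2 * s + y - t - c) / r) : ℂ)) -
        (∫ s in (0 : ℝ)..t, (φ s : ℂ)) * (ψ ((y + t - c) / r) : ℂ)) := by
  have hQ : Integrable (fun ρ => (r : ℂ) * q (r * ρ)) := (hq.comp_mul_left' hr.ne').const_mul _
  have hφc : Continuous (fun s => (φ s : ℂ)) := by fun_prop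
  have key : (fun ρ => (ex (-(ρ * y)) *
      ∫ s in (0 : ℝ)..t, (Real.sin ((t - s) * ρ) : ℂ) * (ex (-(s * ρ)) * φ s)) *
        (ex (c * ρ) * (r * q (r * ρ)))) = fun ρ => (1 / (2 * Complex.I)) *
      ((∫ s in (0 : ℝ)..t, ex (((c - y + t) + (-2) * s) * ρ) * (φ s : ℂ)) * (r * q (r * ρ)) -
        (∫ s in (0 : ℝ)..t, (φ s : ℂ)) * (ex ((c - y - t) * ρ) * (r * q (r * ρ)))) := by
    funext ρ
    have : ex (-(ρ * y)) * (∫ s in (0 : ℝ)..t, (Real.sin ((t - s) * ρ) : ℂ) * (ex (-(s * ρ)) * φ s)) *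
        ex (c * ρ) = (1 / (2 * Complex.I)) *
        ((∫ s in (0 : ℝ)..t, ex (((c - y + t) + (-2) * s) * ρ) * (φ s : ℂ)) -
        (∫ s in (0 : ℝ)..t, (φ s : ℂ)) * (ex ((c - y - t) * ρ))) := by
      rw [← intervalIntegral.integral_mul_const, ← intervalIntegral.integral_sub,
        ← intervalIntegral.integral_const_mul, ← intervalIntegral.integral_const_mul,
        ← intervalIntegral.integral_mul_const]
      · congr 1; funext s
        rw [sin_ex]
        have e1 : ex (((c - y + t) + (-2) * s) * ρ) = ex (-(ρ * y)) * ex ((t - s) * ρ) * ex (-(s * ρ)) * ex (c * ρ) := by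
          rw [← ex_add, ← ex_add, ← ex_add]; congr 1; ring
        have e2 : ex ((c - y - t) * ρ) = ex (-(ρ * y)) * ex (-((t - s) * ρ)) * ex (-(s * ρ)) * ex (c * ρ) := by
          rw [← ex_add, ← ex_add, ← ex_add]; congr 1; ring
        rw [e1, e2]; ring
      · exact Continuous.intervalIntegrable ((ex_cont' (by fun_prop)).mul hφc) _ _
      · exact Continuous.intervalIntegrable (hφc.mul continuous_const) _ _
    rw [← mul_assoc, this]; ring
  obtain ⟨f1, f2⟩ := fub _ hφc _ hQ (c - y + t) (-2) t ht
  have g1 : Integrable (fun ρ => ex ((c - y - t) * ρ) * ((r : ℂ) * q (r * ρ))) :=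
    hQ.bdd_mul (c := 1) (ex_cont' (by fun_prop)).aestronglyMeasurable
      (Filter.Eventually.of_forall fun x => (ex_norm _).le)
  rw [key]
  refine ⟨(f1.sub (g1.const_mul _)).const_mul _, ?_⟩
  rw [integral_const_mul, integral_sub f1 (g1.const_mul _), f2, integral_const_mul,
    scale_int q ψ hqψ r hr]
  simp_rw [scale_int q ψ hqψ r hr]
  have e1 : ∀ s, -(c - y + t + -2 * s) / r = (2 * s + y - t - c) / r := by intro s; congr 1; ring
  have e2 : -(c - y - t) / r = (y + t - c) / r := by congr 1; ring
  simp_rw [e1, e2]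

lemma pairing {n : ℕ} (p q : ℝ → ℂ) (φ ψ : ℝ → ℝ) (hφ : Continuous φ)
    (hp : Integrable p) (hq : Integrable q)
    (hpφ : ∀ s, ∫ σ, ex (-(s * σ)) * p σ = (φ s : ℂ))
    (hqψ : ∀ s, ∫ σ, ex (-(s * σ)) * q σ = (ψ s : ℂ)) (r : ℝ) (hr : 0 < r)
    (t y c : ℝ) (ts ys : Fin n → ℝ) (ht : 0 ≤ t) (hts : ∀ j, 0 ≤ ts j) (coef : Fin n → ℝ)
    (h0 : ∀ s, φ s * ψ ((2 * s + y - t - c) / r) = 0)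
    (hj : ∀ j s, φ s * ψ ((2 * s + ys j - ts j - c) / r) = 0)
    (h0' : ψ ((y + t - c) / r) = 1)
    (hj' : ∀ j, ψ ((ys j + ts j - c) / r) = 0) :
    ∫ ρ, ∫ τ, (Fker t y τ ρ - ∑ j, (coef j : ℂ) * Fker (ts j) (ys j) τ ρ) *
      (p (τ - ρ) * (ex (c * ρ) * (r * q (r * ρ)))) =
      -(1 / (2 * Complex.I)) * ((∫ s in (0 : ℝ)..t, φ s : ℝ) : ℂ) := by
  let J : ℝ → ℝ → ℝ → ℂ := fun t y ρ => ex (-(ρ * y)) *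
      ∫ s in (0 : ℝ)..t, (Real.sin ((t - s) * ρ) : ℂ) * (ex (-(s * ρ)) * φ s)
  have hin : ∀ ρ, ∫ τ, (Fker t y τ ρ - ∑ j, (coef j : ℂ) * Fker (ts j) (ys j) τ ρ) *
      (p (τ - ρ) * (ex (c * ρ) * (r * q (r * ρ)))) =
      J t y ρ * (ex (c * ρ) * (r * q (r * ρ))) -
        ∑ j, (coef j : ℂ) * (J (ts j) (ys j) ρ * (ex (c * ρ) * (r * q (r * ρ)))) := by
    intro ρ
    have i0 := inner_int p φ hp hpφ t y ρ ht
    have ij := fun j => inner_int p φ hp hpφ (ts j) (ys j) ρ (hts j)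
    have e1 : ∀ τ, (Fker t y τ ρ - ∑ j, (coef j : ℂ) * Fker (ts j) (ys j) τ ρ) *
      (p (τ - ρ) * (ex (c * ρ) * (r * q (r * ρ)))) =
      (Fker t y τ ρ * p (τ - ρ) - ∑ j, (coef j : ℂ) * (Fker (ts j) (ys j) τ ρ * p (τ - ρ))) *
        (ex (c * ρ) * (r * q (r * ρ))) := by
      intro τ
      rw [← mul_assoc, sub_mul (Fker t y τ ρ), Finset.sum_mul]
      simp only [mul_assoc]
    simp_rw [e1]
    rw [integral_mul_const, integral_sub i0.1, i0.2, integral_finsetSum]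
    · simp_rw [integral_const_mul, (ij _).2]
      rw [sub_mul, Finset.sum_mul]
      simp only [mul_assoc, J]
    · exact fun j _ => (ij j).1.const_mul _
    · exact integrable_finsetSum _ fun j _ => (ij j).1.const_mul _
  simp_rw [hin]
  have o0 := outer_int φ hφ q ψ hq hqψ r hr t y c ht
  have oj := fun j => outer_int φ hφ q ψ hq hqψ r hr (ts j) (ys j) c (hts j)
  rw [integral_sub o0.1, o0.2, integral_finsetSum]
  · simp_rw [integral_const_mul]
    have : ∀ j, ∫ ρ, J (ts j) (ys j) ρ * (ex (c * ρ) * (r * q (r * ρ))) = 0 := by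
      intro j
      refine (oj j).2.trans ?_
      simp_rw [← Complex.ofReal_mul, hj, hj']
      simp
    simp_rw [this, ← Complex.ofReal_mul, h0, h0']
    simp
    exact intervalIntegral.integral_ofReal
  · exact fun j _ => (oj j).1.const_mul _
  · exact integrable_finsetSum _ fun j _ => (oj j).1.const_mul _

lemma lint_scale (g : ℝ → ℝ≥0∞) (hg : Measurable g) (r : ℝ) (hr : 0 < r) :
    ∫⁻ ρ, g (r * ρ) = ENNReal.ofReal r⁻¹ * ∫⁻ u, g u := by
  rw [← lintegral_map hg (measurable_const_mul r), Real.map_volume_mul_left hr.ne',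
    lintegral_smul_measure, abs_of_pos (inv_pos.2 hr)]
  rfl

lemma M_bound (p q : ℝ → ℂ) (hpc : Continuous p) (hqc : Continuous q)
    (hp : ∀ e : ℝ, 0 ≤ e → ∫⁻ σ, ENNReal.ofReal (‖p σ‖ ^ 2 * |σ| ^ e) < ⊤)
    (hq : ∀ e : ℝ, 0 ≤ e → ∫⁻ σ, ENNReal.ofReal (‖q σ‖ ^ 2 * |σ| ^ e) < ⊤)
    (γ e b : ℝ) (hγ0 : 0 ≤ γ) (hγ1 : γ ≤ 1) (he : 0 ≤ e) (hb : 0 < b) :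
    ∃ Q : ℝ, 0 < Q ∧ ∀ r : ℝ, 0 < r → r ≤ b → ∀ c : ℝ,
      ∫⁻ ρ, ∫⁻ τ, ENNReal.ofReal (‖p (τ - ρ) * (ex (c * ρ) * (r * q (r * ρ)))‖ ^ 2 *
        |τ| ^ γ * |ρ| ^ e) ≤ ENNReal.ofReal (Q * r ^ (1 - e - γ)) := by
  set A1 := ∫⁻ σ, ENNReal.ofReal (‖p σ‖ ^ 2 * |σ| ^ γ) with hA1
  set A0 := ∫⁻ σ, ENNReal.ofReal (‖p σ‖ ^ 2 * |σ| ^ (0 : ℝ)) with hA0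
  have hA1t : A1 < ⊤ := hp γ hγ0
  have hA0t : A0 < ⊤ := hp 0 le_rfl
  set P1 := A1.toReal
  set P0 := A0.toReal
  have hP1 : ENNReal.ofReal P1 = A1 := ENNReal.ofReal_toReal hA1t.ne
  have hP0 : ENNReal.ofReal P0 = A0 := ENNReal.ofReal_toReal hA0t.ne
  have hP1n : 0 ≤ P1 := ENNReal.toReal_nonneg
  have hP0n : 0 ≤ P0 := ENNReal.toReal_nonneg
  set g : ℝ → ℝ := fun u => P1 * b ^ γ * (‖q u‖ ^ 2 * |u| ^ e) + P0 * (‖q u‖ ^ 2 * |u| ^ (e + γ)) with hg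
  have hgn : ∀ u, 0 ≤ g u := fun u => by simp only [hg]; positivity
  have hgm : Measurable g := by
    have := hqc.measurable
    simp only [hg]; fun_prop
  set B := ∫⁻ u, ENNReal.ofReal (g u) with hB
  have hBt : B < ⊤ := by
    have : B = ENNReal.ofReal (P1 * b ^ γ) * (∫⁻ σ, ENNReal.ofReal (‖q σ‖ ^ 2 * |σ| ^ e)) +
        ENNReal.ofReal P0 * (∫⁻ σ, ENNReal.ofReal (‖q σ‖ ^ 2 * |σ| ^ (e + γ))) := by
      have hqm := hqc.measurable
      rw [← lintegral_const_mul _ (by fun_prop), ← lintegral_const_mul _ (by fun_prop),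
        ← lintegral_add_left (by fun_prop)]
      rw [hB]; congr 1; funext u
      rw [← ENNReal.ofReal_mul (by positivity), ← ENNReal.ofReal_mul (by positivity),
        ← ENNReal.ofReal_add (by positivity) (by positivity)]
    rw [this]
    exact ENNReal.add_lt_top.2 ⟨ENNReal.mul_lt_top ENNReal.ofReal_lt_top (hq _ he),
      ENNReal.mul_lt_top ENNReal.ofReal_lt_top (hq _ (by linarith))⟩
  refine ⟨B.toReal + 1, by positivity, ?_⟩
  intro r hr hrb c
  have inner : ∀ ρ, ∫⁻ τ, ENNReal.ofReal (‖p (τ - ρ) * (ex (c * ρ) * (r * q (r * ρ)))‖ ^ 2 *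
        |τ| ^ γ * |ρ| ^ e) ≤ ENNReal.ofReal (r ^ (2 - e - γ) * g (r * ρ)) := by
    intro ρ
    set K := r * ‖q (r * ρ)‖ with hK
    have hK0 : 0 ≤ K := by positivity
    have pt : ∀ τ, ENNReal.ofReal (‖p (τ - ρ) * (ex (c * ρ) * (r * q (r * ρ)))‖ ^ 2 *
        |τ| ^ γ * |ρ| ^ e) ≤ ENNReal.ofReal (K ^ 2 * |ρ| ^ e) *
          (ENNReal.ofReal (‖p (τ - ρ)‖ ^ 2 * |τ - ρ| ^ γ) +
            ENNReal.ofReal (|ρ| ^ γ) * ENNReal.ofReal (‖p (τ - ρ)‖ ^ 2 * |τ - ρ| ^ (0 : ℝ))) := by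
      intro τ
      rw [← ENNReal.ofReal_mul (by positivity), ← ENNReal.ofReal_add (by positivity) (by positivity),
        ← ENNReal.ofReal_mul (by positivity)]
      apply ENNReal.ofReal_le_ofReal
      have hT : ‖p (τ - ρ) * (ex (c * ρ) * (r * q (r * ρ)))‖ = ‖p (τ - ρ)‖ * K := by
        rw [norm_mul, norm_mul, norm_mul, ex_norm, one_mul, Complex.norm_real, Real.norm_eq_abs,
          abs_of_pos hr]
      rw [hT, Real.rpow_zero]
      have h1 : |τ| ^ γ ≤ |τ - ρ| ^ γ + |ρ| ^ γ := by
        refine le_trans (Real.rpow_le_rpow (abs_nonneg _) ?_ hγ0)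
          (Real.rpow_add_le_add_rpow (abs_nonneg _) (abs_nonneg _) hγ0 hγ1)
        calc |τ| = |(τ - ρ) + ρ| := by ring_nf
          _ ≤ _ := abs_add_le _ _
      calc _ = K ^ 2 * |ρ| ^ e * (‖p (τ - ρ)‖ ^ 2 * |τ| ^ γ) := by ring
        _ ≤ K ^ 2 * |ρ| ^ e * (‖p (τ - ρ)‖ ^ 2 * (|τ - ρ| ^ γ + |ρ| ^ γ)) := by gcongr
        _ = _ := by ring
    have hpm := hpc.measurable
    refine (lintegral_mono pt).trans ?_
    rw [lintegral_const_mul _ (by fun_prop), lintegral_add_left (by fun_prop),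
      lintegral_const_mul _ (by fun_prop),
      lintegral_sub_right_eq_self (fun σ => ENNReal.ofReal (‖p σ‖ ^ 2 * |σ| ^ γ)) ρ,
      lintegral_sub_right_eq_self (fun σ => ENNReal.ofReal (‖p σ‖ ^ 2 * |σ| ^ (0 : ℝ))) ρ,
      ← hA1, ← hA0, ← hP1, ← hP0, ← ENNReal.ofReal_mul (by positivity),
      ← ENNReal.ofReal_add (by positivity) (by positivity), ← ENNReal.ofReal_mul (by positivity)]
    apply ENNReal.ofReal_le_ofReal
    simp only [hg]
    have hab : |r * ρ| = r * |ρ| := by rw [abs_mul, abs_of_pos hr]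
    rw [hab, Real.mul_rpow hr.le (abs_nonneg _), Real.mul_rpow hr.le (abs_nonneg _)]
    have s1 : r ^ (2 - e - γ) * r ^ e * r ^ γ = r ^ 2 := by
      rw [← Real.rpow_add hr, ← Real.rpow_add hr, ← Real.rpow_natCast]; congr 1; push_cast; ring
    have s2 : r ^ (2 - e - γ) * r ^ (e + γ) = r ^ 2 := by
      rw [← Real.rpow_add hr, ← Real.rpow_natCast]; congr 1; push_cast; ring
    have s3 : |ρ| ^ (e + γ) = |ρ| ^ e * |ρ| ^ γ :=
      Real.rpow_add_of_nonneg (abs_nonneg _) he hγ0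
    have s4 : r ^ γ ≤ b ^ γ := Real.rpow_le_rpow hr.le hrb hγ0
    calc K ^ 2 * |ρ| ^ e * (P1 + |ρ| ^ γ * P0)
        = P1 * (r ^ (2 - e - γ) * r ^ e * r ^ γ) * (‖q (r * ρ)‖ ^ 2 * |ρ| ^ e) +
          P0 * (r ^ (2 - e - γ) * r ^ (e + γ)) * (‖q (r * ρ)‖ ^ 2 * |ρ| ^ e * |ρ| ^ γ) := by
          rw [s1, s2, hK]; ring
      _ ≤ P1 * (r ^ (2 - e - γ) * r ^ e * b ^ γ) * (‖q (r * ρ)‖ ^ 2 * |ρ| ^ e) +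
          P0 * (r ^ (2 - e - γ) * r ^ (e + γ)) * (‖q (r * ρ)‖ ^ 2 * |ρ| ^ e * |ρ| ^ γ) := by
          gcongr
      _ = _ := by rw [s3]; ring
  refine (lintegral_mono inner).trans ?_
  have hs := lint_scale (fun u => ENNReal.ofReal (g u)) (by fun_prop) r hr
  simp_rw [ENNReal.ofReal_mul (p := r ^ (2 - e - γ)) (by positivity)]
  rw [lintegral_const_mul _ (by fun_prop), hs, ← hB, ← ENNReal.ofReal_toReal hBt.ne,
    ← ENNReal.ofReal_mul (by positivity), ← ENNReal.ofReal_mul (by positivity)]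
  apply ENNReal.ofReal_le_ofReal
  rw [ENNReal.toReal_ofReal ENNReal.toReal_nonneg]
  have : r ^ (2 - e - γ) * (r⁻¹ * B.toReal) = B.toReal * r ^ (1 - e - γ) := by
    rw [← Real.rpow_neg_one, ← mul_assoc, ← Real.rpow_add hr, mul_comm]
    congr 2; ring
  rw [this]
  gcongr
  linarith

lemma split_bound (N : ℕ) (H β : ℝ) (D T : ℝ → ℝ → ℂ) (M k ε : ℝ) (hkpos : 0 < k)
    (hMpos : 0 < M) (hε : ε = M / (2 * k)) (hεpos : 0 < ε)
    (hTm : Measurable (fun z : ℝ × ℝ => ENNReal.ofReal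
          (‖T z.2 z.1‖ ^ 2 * |z.2| ^ (2 * H - 1) * |z.1| ^ (3 + β - N))))
    (hMT : ∫⁻ ρ, ∫⁻ τ, ENNReal.ofReal (‖T τ ρ‖ ^ 2 * |τ| ^ (2 * H - 1) * |ρ| ^ (3 + β - N)) ≤
      ENNReal.ofReal M) :
    ∫⁻ ρ, ∫⁻ τ, ‖D τ ρ * T τ ρ‖ₑ ≤ ENNReal.ofReal ε * (∫⁻ ρ, ∫⁻ τ, ENNReal.ofReal
    (‖D τ ρ‖ ^ 2 * |τ| ^ (1 - 2 * H) * |ρ| ^ ((N : ℝ) - β - 3))) + ENNReal.ofReal (k / 2) := by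
  set A := ∫⁻ ρ, ∫⁻ τ, ENNReal.ofReal
    (‖D τ ρ‖ ^ 2 * |τ| ^ (1 - 2 * H) * |ρ| ^ ((N : ℝ) - β - 3)) with hA
  have pt : ∀ τ ρ : ℝ, τ ≠ 0 → ρ ≠ 0 → ‖D τ ρ * T τ ρ‖ₑ ≤
      ENNReal.ofReal ε * ENNReal.ofReal
        (‖D τ ρ‖ ^ 2 * |τ| ^ (1 - 2 * H) * |ρ| ^ ((N : ℝ) - β - 3)) +
      ENNReal.ofReal (1 / (4 * ε)) * ENNReal.ofReal
        (‖T τ ρ‖ ^ 2 * |τ| ^ (2 * H - 1) * |ρ| ^ (3 + β - N)) := by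
    intro τ ρ hτ hρ
    rw [← ofReal_norm, ← ENNReal.ofReal_mul (by positivity),
      ← ENNReal.ofReal_mul (by positivity), ← ENNReal.ofReal_add (by positivity) (by positivity)]
    apply ENNReal.ofReal_le_ofReal
    have e1 : 1 - 2 * H = -(2 * H - 1) := by ring
    have e2 : (N : ℝ) - β - 3 = -(3 + β - N) := by ring
    rw [e1, e2, Real.rpow_neg (abs_nonneg _), Real.rpow_neg (abs_nonneg _), norm_mul]
    have w1 : 0 < |τ| ^ (2 * H - 1) := Real.rpow_pos_of_pos (abs_pos.2 hτ) _
    have w2 : 0 < |ρ| ^ (3 + β - N) := Real.rpow_pos_of_pos (abs_pos.2 hρ) _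
    generalize |τ| ^ (2 * H - 1) = W1 at *
    generalize |ρ| ^ (3 + β - N) = W2 at *
    generalize ‖D τ ρ‖ = X
    generalize ‖T τ ρ‖ = Y
    have : ε * (X ^ 2 * W1⁻¹ * W2⁻¹) + 1 / (4 * ε) * (Y ^ 2 * W1 * W2) - X * Y =
        (2 * ε * X - Y * W1 * W2) ^ 2 / (4 * ε * W1 * W2) := by
      field_simp; ring
    have h2 : 0 ≤ (2 * ε * X - Y * W1 * W2) ^ 2 / (4 * ε * W1 * W2) := by positivity
    linarith
  have hTm1 : ∀ ρ : ℝ, Measurable (fun τ : ℝ => ENNReal.ofReal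
        (‖T τ ρ‖ ^ 2 * |τ| ^ (2 * H - 1) * |ρ| ^ (3 + β - N))) := fun ρ =>
    hTm.comp (g := fun z : ℝ × ℝ => ENNReal.ofReal (‖T z.2 z.1‖ ^ 2 * |z.2| ^ (2 * H - 1) * |z.1| ^ (3 + β - N))) (f := fun τ : ℝ => (ρ, τ)) measurable_prodMk_left
  have hTm2 : Measurable (fun ρ : ℝ => ∫⁻ τ, ENNReal.ofReal
        (‖T τ ρ‖ ^ 2 * |τ| ^ (2 * H - 1) * |ρ| ^ (3 + β - N))) :=
    hTm.lintegral_prod_right'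
  calc ∫⁻ ρ, ∫⁻ τ, ‖D τ ρ * T τ ρ‖ₑ
      ≤ ∫⁻ ρ, (ENNReal.ofReal ε * (∫⁻ τ, ENNReal.ofReal
        (‖D τ ρ‖ ^ 2 * |τ| ^ (1 - 2 * H) * |ρ| ^ ((N : ℝ) - β - 3))) +
      ENNReal.ofReal (1 / (4 * ε)) * (∫⁻ τ, ENNReal.ofReal
        (‖T τ ρ‖ ^ 2 * |τ| ^ (2 * H - 1) * |ρ| ^ (3 + β - N)))) := by
        apply lintegral_mono_ae
        filter_upwards [Measure.ae_ne volume (0 : ℝ)] with ρ hρ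
        rw [← lintegral_const_mul' _ _ ENNReal.ofReal_ne_top, ← lintegral_const_mul _ (hTm1 ρ),
          ← lintegral_add_right _ ((hTm1 ρ).const_mul _)]
        apply lintegral_mono_ae
        filter_upwards [Measure.ae_ne volume (0 : ℝ)] with τ hτ
        exact pt τ ρ hτ hρ
    _ = ENNReal.ofReal ε * A + ENNReal.ofReal (1 / (4 * ε)) * ∫⁻ ρ, ∫⁻ τ, ENNReal.ofReal
        (‖T τ ρ‖ ^ 2 * |τ| ^ (2 * H - 1) * |ρ| ^ (3 + β - N)) := by
        rw [lintegral_add_right _ (hTm2.const_mul _), lintegral_const_mul' _ _ ENNReal.ofReal_ne_top,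
          lintegral_const_mul _ hTm2]
    _ ≤ ENNReal.ofReal ε * A + ENNReal.ofReal (1 / (4 * ε)) * ENNReal.ofReal M := by gcongr
    _ = ENNReal.ofReal ε * A + ENNReal.ofReal (k / 2) := by
        rw [← ENNReal.ofReal_mul (by positivity)]
        congr 2
        rw [hε]; field_simp; ring

lemma T_meas (N : ℕ) (H β : ℝ) (p q : ℝ → ℂ) (hpc : Continuous p) (hqc : Continuous q) (r c : ℝ) :
    Measurable (fun z : ℝ × ℝ => ENNReal.ofReal
      (‖p (z.2 - z.1) * (ex (c * z.1) * (r * q (r * z.1)))‖ ^ 2 * |z.2| ^ (2 * H - 1) *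
        |z.1| ^ (3 + β - N))) := by
  have h1 : Measurable (fun z : ℝ × ℝ => ‖p (z.2 - z.1) * (ex (c * z.1) * (r * q (r * z.1)))‖) := by
    have h3 := ex_cont
    apply Continuous.measurable
    fun_prop
  exact (((h1.pow_const 2).mul (measurable_snd.abs.pow_const _)).mul
    (measurable_fst.abs.pow_const _)).ennreal_ofReal

/-- The directional lower bound `A(w) ≥ C r(w)^{2H+1−N+β}`, the key step in the proof of
the spherical strong local nondeterminism of the stochastic wave equation. The constant
`C` does not depend on the direction `w`, on `n`, on the points, nor on the coefficients. -/
theorem directional_lower_bound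
    (N : ℕ) (hN : 1 ≤ N) (H β : ℝ) (hH1 : 1 / 2 ≤ H) (hH2 : H < 1)
    (hβ0 : 0 < β) (hβN : β < N)
    (hβlow : (N : ℝ) - 2 * H - 1 < β) (hβup : β < (N : ℝ) - 2 * H + 1)
    (a : ℝ) (ha : 0 < a) :
    ∃ C : ℝ, 0 < C ∧
      ∀ w : EuclideanSpace ℝ (Fin N), ‖w‖ = 1 →
        ∀ n : ℕ, 1 ≤ n →
          ∀ (t : ℝ) (x : EuclideanSpace ℝ (Fin N))
            (ts : Fin n → ℝ) (xs : Fin n → EuclideanSpace ℝ (Fin N)),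
            a ≤ t → (∀ j, a ≤ ts j) →
            (∀ j, |t - ts j| + ‖x - xs j‖ ≤ a / 2) →
            ∀ coef : Fin n → ℝ,
              ENNReal.ofReal
                  (C * (⨅ j, |(t - ts j) + (inner ℝ (x - xs j) w : ℝ)|) ^
                    (2 * H + 1 - N + β)) ≤
                ∫⁻ ρ : ℝ, ∫⁻ τ : ℝ,
                  ENNReal.ofReal
                    (norm
                        (Fker t (inner ℝ x w : ℝ) τ ρ -
                          ∑ j, (coef j : ℂ) * Fker (ts j) (inner ℝ (xs j) w : ℝ) τ ρ) ^ 2 *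
                      |τ| ^ (1 - 2 * H) * |ρ| ^ ((N : ℝ) - β - 3)) := by
  obtain ⟨p, φ, hpc, hpi, hφc, hφ0, hφm, hφs, hpφ, hpe⟩ := exists_test (a / 4) (a / 4) (by positivity)
  obtain ⟨q, ψ, hqc, hqi, hψc, hψ0, hψm, hψs, hqψ, hqe⟩ := exists_test 0 1 one_pos
  obtain ⟨Q, hQ, hM⟩ := M_bound p q hpc hqc hpe hqe (2 * H - 1) (3 + β - N) (a / 2)
    (by linarith) (by linarith) (by linarith) (by positivity)
  set k0 := ∫ s in (0 : ℝ)..a, φ s with hk0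
  have hk0pos : 0 < k0 := by
    apply intervalIntegral.integral_pos ha hφc.continuousOn (fun x _ => hφ0 x)
    exact ⟨a / 4, ⟨by positivity, by linarith⟩, by rw [hφm]; exact one_pos⟩
  set k := k0 / 2 with hk
  have hkpos : 0 < k := by positivity
  refine ⟨k ^ 2 / Q, by positivity, ?_⟩
  intro w hw n hn t x ts xs hta htsa hclose coef
  have : Nonempty (Fin n) := ⟨⟨0, hn⟩⟩
  set r := ⨅ j, |(t - ts j) + (inner ℝ (x - xs j) w : ℝ)| with hr
  have hrle : ∀ j, r ≤ |(t - ts j) + (inner ℝ (x - xs j) w : ℝ)| := fun j =>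
    ciInf_le (Set.finite_range _).bddBelow j
  have hr0 : 0 ≤ r := le_ciInf fun j => abs_nonneg _
  have hin : ∀ j, |(inner ℝ (x - xs j) w : ℝ)| ≤ ‖x - xs j‖ := fun j => by
    simpa [hw] using abs_real_inner_le_norm (x - xs j) w
  have hrb : r ≤ a / 2 := by
    let j : Fin n := ⟨0, hn⟩
    have h1 := hrle j
    have h2 := abs_add_le (t - ts j) (inner ℝ (x - xs j) w : ℝ)
    have h3 := hin j
    have h4 := hclose j
    linarith
  have hθ : 0 < 2 * H + 1 - N + β := by linarith
  rcases hr0.eq_or_lt with h | hrpos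
  · rw [← h, Real.zero_rpow hθ.ne']; simp
  set y : ℝ := inner ℝ x w with hy
  set ys : Fin n → ℝ := fun j => inner ℝ (xs j) w with hys
  have hyj : ∀ j, (inner ℝ (x - xs j) w : ℝ) = y - ys j := fun j => inner_sub_left _ _ _
  have ht0 : 0 ≤ t := by linarith
  have hφz : ∀ s, φ s ≠ 0 → 0 < s ∧ s < a / 2 := by
    intro s hs
    by_contra hcon
    apply hs; apply hφs
    rw [not_and_or] at hcon
    rcases hcon with h | h
    · rw [abs_of_nonpos (by linarith)]; linarith
    · rw [abs_of_nonneg (by linarith)]; linarith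
  have hψz : ∀ u, r ≤ |u| → ψ (u / r) = 0 := by
    intro u hu
    apply hψs
    rw [sub_zero, abs_div, abs_of_pos hrpos, one_le_div hrpos]; exact hu
  have hpair := pairing (n := n) p q φ ψ hφc hpi hqi hpφ hqψ r hrpos t y (y + t) ts ys ht0
    (fun j => by linarith [htsa j]) coef
    (by
      intro s
      by_cases hs : φ s = 0
      · rw [hs, zero_mul]
      · have := hφz s hs
        rw [hψz, mul_zero]
        rw [abs_of_nonpos (by linarith)]; linarith)
    (by
      intro j s
      by_cases hs : φ s = 0
      · rw [hs, zero_mul]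
      · have h1 := hφz s hs
        have h2 := hclose j
        have h3 := hin j
        rw [hyj] at h3
        have h4 := htsa j
        have h5 := neg_abs_le (y - ys j)
        have h6 := abs_nonneg (t - ts j)
        rw [hψz, mul_zero]
        rw [abs_of_nonpos (by linarith)]; linarith)
    (by rw [sub_self, zero_div, hψm])
    (by
      intro j
      apply hψz
      have := hrle j
      rw [hyj, ← abs_neg] at this
      convert this using 2; ring)
  set D : ℝ → ℝ → ℂ := fun τ ρ => Fker t y τ ρ - ∑ j, (coef j : ℂ) * Fker (ts j) (ys j) τ ρ with hD
  set T : ℝ → ℝ → ℂ := fun τ ρ => p (τ - ρ) * (ex ((y + t) * ρ) * (r * q (r * ρ))) with hT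
  change ENNReal.ofReal _ ≤ ∫⁻ ρ, ∫⁻ τ, ENNReal.ofReal
    (‖D τ ρ‖ ^ 2 * |τ| ^ (1 - 2 * H) * |ρ| ^ ((N : ℝ) - β - 3))
  set A := ∫⁻ ρ, ∫⁻ τ, ENNReal.ofReal
    (‖D τ ρ‖ ^ 2 * |τ| ^ (1 - 2 * H) * |ρ| ^ ((N : ℝ) - β - 3)) with hA
  have hL : ENNReal.ofReal k ≤ ∫⁻ ρ, ∫⁻ τ, ‖D τ ρ * T τ ρ‖ₑ := by
    have h1 : ‖∫ ρ, ∫ τ, D τ ρ * T τ ρ‖ₑ ≤ ∫⁻ ρ, ∫⁻ τ, ‖D τ ρ * T τ ρ‖ₑ :=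
      (enorm_integral_le_lintegral_enorm _).trans
        (lintegral_mono fun ρ => enorm_integral_le_lintegral_enorm _)
    refine le_trans ?_ h1
    rw [hpair, ← ofReal_norm]
    apply ENNReal.ofReal_le_ofReal
    have h2 : k0 ≤ ∫ s in (0 : ℝ)..t, φ s :=
      intervalIntegral.integral_mono_interval le_rfl ha.le hta
        (Filter.Eventually.of_forall hφ0) (hφc.intervalIntegrable _ _)
    rw [norm_mul, Complex.norm_real, Real.norm_eq_abs, abs_of_nonneg (by linarith)]
    have : ‖-(1 / (2 * Complex.I))‖ = 1 / 2 := by simp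
    rw [this, hk]; linarith
  set θ := 2 * H + 1 - N + β with hθdef
  set M := Q * r ^ (-θ) with hMdef
  have hMpos : 0 < M := by positivity
  have hMT : ∫⁻ ρ, ∫⁻ τ, ENNReal.ofReal (‖T τ ρ‖ ^ 2 * |τ| ^ (2 * H - 1) * |ρ| ^ (3 + β - N)) ≤
      ENNReal.ofReal M := by
    have := hM r hrpos hrb (y + t)
    have e1 : 1 - (3 + β - N) - (2 * H - 1) = -θ := by rw [hθdef]; ring
    rw [e1] at this
    exact this
  set ε := M / (2 * k) with hε
  have hεpos : 0 < ε := by positivity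
  have hsplit : ∫⁻ ρ, ∫⁻ τ, ‖D τ ρ * T τ ρ‖ₑ ≤ ENNReal.ofReal ε * A + ENNReal.ofReal (k / 2) := 
    split_bound N H β D T M k ε hkpos hMpos hε hεpos (T_meas N H β p q hpc hqc r (y + t)) hMT
  have hfin : ENNReal.ofReal (k / 2) ≤ ENNReal.ofReal ε * A := by
    have h1 := hL.trans hsplit
    have h2 : ENNReal.ofReal k = ENNReal.ofReal (k / 2) + ENNReal.ofReal (k / 2) := by
      rw [← ENNReal.ofReal_add (by positivity) (by positivity)]; congr 1; ring
    rw [h2] at h1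
    exact (ENNReal.add_le_add_iff_right ENNReal.ofReal_ne_top).1 h1
  calc ENNReal.ofReal (k ^ 2 / Q * r ^ θ) = ENNReal.ofReal ε⁻¹ * ENNReal.ofReal (k / 2) := by
        rw [← ENNReal.ofReal_mul (by positivity)]
        congr 1
        rw [hε, hMdef, Real.rpow_neg hrpos.le]
        field_simp
    _ ≤ ENNReal.ofReal ε⁻¹ * (ENNReal.ofReal ε * A) := by gcongr
    _ = A := by
        rw [← mul_assoc, ← ENNReal.ofReal_mul (by positivity), inv_mul_cancel₀ hεpos.ne']
        simp
end

section
/- Let φ and ψ be Schwartz functions on ℝ, i.e. both φ̂ and ψ̂ are rapidly decreasing. Then there exists a constant C < ∞ such that for all 0 < r ≤ 1: ∫_ℝ ∫_ℝ |φ̂(τ − ρ)|² |ψ̂(rρ)|² |τ|^{2H−1} |ρ|^{3−N+β} dτ dρ ≤ C r^{−(2H+3−N+β)}. -/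
open MeasureTheory Set
open scoped ENNReal

/-- The Fourier transform `f̂(τ) = ∫_ℝ e^{−isτ} f(s) ds` of a real function on `ℝ`. -/
noncomputable def fhat (f : ℝ → ℝ) (τ : ℝ) : ℂ :=
  ∫ s : ℝ, Complex.exp (-Complex.I * (s : ℂ) * (τ : ℂ)) * (f s : ℂ)

open FourierTransform in
/-- Rapid decay of `fhat` of a Schwartz function. -/
lemma fhat_decay (φ : SchwartzMap ℝ ℝ) (k : ℕ) :
    ∃ K : ℝ, ∀ x : ℝ, (1 + |x|) ^ k * ‖fhat (fun s => φ s) x‖ ≤ K := by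
  let g : SchwartzMap ℝ ℂ := SchwartzMap.postcompCLM (𝕜 := ℝ) Complex.ofRealCLM φ
  have hg : ∀ s, g s = (φ s : ℂ) := fun s => rfl
  have hF : ∀ x : ℝ, fhat (fun s => φ s) x = (𝓕 g) (x / (2 * Real.pi)) := by
    intro x
    rw [SchwartzMap.fourier_coe, Real.fourier_real_eq_integral_exp_smul]
    unfold fhat
    congr 1
    ext s
    rw [hg, smul_eq_mul]
    congr 2
    have : (Real.pi : ℂ) ≠ 0 := by exact_mod_cast Real.pi_ne_zero
    push_cast
    field_simp
  obtain ⟨K, hK⟩ : ∃ K : ℝ, ∀ y : ℝ, (1 + |y|) ^ k * ‖(𝓕 g) y‖ ≤ K := by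
    refine ⟨2 ^ k * (Finset.Iic (k, 0)).sup (fun m => SchwartzMap.seminorm ℝ m.1 m.2) (𝓕 g),
      fun y => ?_⟩
    have h := SchwartzMap.one_add_le_sup_seminorm_apply (𝕜 := ℝ) (m := (k, 0)) (k := k) (n := 0)
      le_rfl le_rfl (𝓕 g) y
    rw [norm_iteratedFDeriv_zero, Real.norm_eq_abs] at h
    exact h
  refine ⟨(2 * Real.pi) ^ k * K, fun x => ?_⟩
  have hpi : 1 ≤ 2 * Real.pi := by linarith [Real.pi_gt_three]
  have hpos : 0 < 2 * Real.pi := by linarith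
  have h1 : 1 + |x| ≤ 2 * Real.pi * (1 + |x / (2 * Real.pi)|) := by
    rw [abs_div, abs_of_pos hpos, mul_add, mul_div_cancel₀ _ hpos.ne']
    linarith
  rw [hF]
  calc (1 + |x|) ^ k * ‖(𝓕 g) (x / (2 * Real.pi))‖
      ≤ (2 * Real.pi * (1 + |x / (2 * Real.pi)|)) ^ k * ‖(𝓕 g) (x / (2 * Real.pi))‖ := by
        gcongr
    _ = (2 * Real.pi) ^ k * ((1 + |x / (2 * Real.pi)|) ^ k * ‖(𝓕 g) (x / (2 * Real.pi))‖) := by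
        rw [mul_pow]; ring
    _ ≤ _ := by gcongr; exact hK _

lemma fhat_sq_decay (φ : SchwartzMap ℝ ℝ) (p : ℝ) :
    ∃ K : ℝ, 0 ≤ K ∧ ∀ x : ℝ, (1 + |x|) ^ p * ‖fhat (fun s => φ s) x‖ ^ 2 ≤
      K * (1 + |x|) ^ (-2 : ℝ) := by
  obtain ⟨k, hk⟩ := exists_nat_ge (p + 2)
  obtain ⟨K, hK⟩ := fhat_decay φ k
  refine ⟨K ^ 2, sq_nonneg _, fun x => ?_⟩
  have h1 : 1 ≤ 1 + |x| := by linarith [abs_nonneg x]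
  have h0 : 0 < 1 + |x| := by linarith
  have hp : (1 + |x|) ^ p ≤ ((1 + |x|) ^ k) ^ 2 * (1 + |x|) ^ (-2 : ℝ) := by
    rw [← pow_mul, ← Real.rpow_natCast, ← Real.rpow_add h0]
    apply Real.rpow_le_rpow_of_exponent_le h1
    push_cast
    have : (0 : ℝ) ≤ k := Nat.cast_nonneg k
    linarith
  calc (1 + |x|) ^ p * ‖fhat (fun s => φ s) x‖ ^ 2
      ≤ ((1 + |x|) ^ k) ^ 2 * (1 + |x|) ^ (-2 : ℝ) * ‖fhat (fun s => φ s) x‖ ^ 2 := by gcongr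
    _ = ((1 + |x|) ^ k * ‖fhat (fun s => φ s) x‖) ^ 2 * (1 + |x|) ^ (-2 : ℝ) := by ring
    _ ≤ _ := by
      gcongr
      exact hK x

lemma weight_bound (a b r τ ρ : ℝ) (ha : 0 ≤ a) (hb : 0 ≤ b) (hr : 0 < r) (hr1 : r ≤ 1) :
    |τ| ^ a * |ρ| ^ b ≤
      r ^ (-(a + b)) * ((1 + |τ - ρ|) ^ (a + b) * (1 + |r * ρ|) ^ (a + b)) := by
  have h0 : 0 ≤ |ρ| := abs_nonneg _
  have h0' : 0 ≤ |τ - ρ| := abs_nonneg _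
  have h1 : |τ| ≤ (1 + |τ - ρ|) * (1 + |ρ|) := by
    have : |τ| ≤ |τ - ρ| + |ρ| := by simpa using abs_add_le (τ - ρ) ρ
    nlinarith
  have h2 : 1 + |ρ| ≤ r⁻¹ * (1 + |r * ρ|) := by
    rw [abs_mul, abs_of_pos hr, mul_add, inv_mul_cancel_left₀ hr.ne']
    have := (one_le_inv₀ hr).2 hr1
    linarith
  calc |τ| ^ a * |ρ| ^ b ≤ ((1 + |τ - ρ|) * (1 + |ρ|)) ^ a * (1 + |ρ|) ^ b := by
        gcongr; linarith
    _ = (1 + |τ - ρ|) ^ a * (1 + |ρ|) ^ (a + b) := by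
        rw [Real.mul_rpow (by positivity) (by positivity), Real.rpow_add (by positivity)]; ring
    _ ≤ (1 + |τ - ρ|) ^ (a + b) * (r⁻¹ * (1 + |r * ρ|)) ^ (a + b) := by
        gcongr <;> linarith
    _ = _ := by
        rw [Real.mul_rpow (by positivity) (by positivity), Real.inv_rpow hr.le, Real.rpow_neg hr.le]
        ring


/-- The estimate on the double integral appearing in the Cauchy–Schwarz step of the proof
of the spherical strong local nondeterminism: for Schwartz functions `φ, ψ` on `ℝ` and
`0 < r ≤ 1`,
`∫∫ |φ̂(τ−ρ)|² |ψ̂(rρ)|² |τ|^{2H−1} |ρ|^{3−N+β} dτ dρ ≤ C r^{−(2H+3−N+β)}`. -/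
theorem double_integral_estimate
    (N : ℕ) (hN : 1 ≤ N) (H β : ℝ) (hH1 : 1 / 2 ≤ H) (hH2 : H < 1)
    (hβ0 : 0 < β) (hβN : β < N)
    (hβlow : (N : ℝ) - 2 * H - 1 < β) (hβup : β < (N : ℝ) - 2 * H + 1)
    (φ ψ : SchwartzMap ℝ ℝ) :
    ∃ C : ℝ, ∀ r : ℝ, 0 < r → r ≤ 1 →
      (∫⁻ τ : ℝ, ∫⁻ ρ : ℝ,
          ENNReal.ofReal
            (‖fhat (fun s => φ s) (τ - ρ)‖ ^ 2 *
              ‖fhat (fun s => ψ s) (r * ρ)‖ ^ 2 *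
              |τ| ^ (2 * H - 1) * |ρ| ^ (3 - (N : ℝ) + β))) ≤
        ENNReal.ofReal (C * r ^ (-(2 * H + 3 - N + β))) := by
  obtain ⟨K, hK0, hK⟩ := fhat_sq_decay φ (2 * H - 1 + (3 - N + β))
  obtain ⟨L, hL0, hL⟩ := fhat_sq_decay ψ (2 * H - 1 + (3 - N + β))
  have ha : 0 ≤ 2 * H - 1 := by linarith
  have hb : 0 ≤ 3 - (N : ℝ) + β := by linarith
  have hI : Integrable (fun x : ℝ => (1 + |x|) ^ (-2 : ℝ)) := by
    have h := integrable_one_add_norm (E := ℝ) (μ := volume) (r := 2) (by simp)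
    simpa only [Real.norm_eq_abs] using h
  have hw : ∀ x : ℝ, 0 ≤ (1 + |x|) ^ (-2 : ℝ) := fun x => by positivity
  set w : ℝ → ℝ := fun x => (1 + |x|) ^ (-2 : ℝ) with hwdef
  have hwm : Measurable w := by rw [hwdef]; fun_prop
  set J : ℝ := ∫ x, w x with hJ
  have hJ0 : 0 ≤ J := integral_nonneg hw
  have hJI : ∫⁻ x, ENNReal.ofReal (w x) = ENNReal.ofReal J :=
    (ofReal_integral_eq_lintegral_ofReal hI (ae_of_all _ hw)).symm
  refine ⟨K * L * J * J, fun r hr hr1 => ?_⟩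
  set M : ℝ := K * L * r ^ (-(2 * H - 1 + (3 - N + β))) with hM
  have hM0 : 0 ≤ M := by positivity
  have hpt : ∀ τ ρ : ℝ, ENNReal.ofReal (‖fhat (fun s => φ s) (τ - ρ)‖ ^ 2 *
              ‖fhat (fun s => ψ s) (r * ρ)‖ ^ 2 *
              |τ| ^ (2 * H - 1) * |ρ| ^ (3 - (N : ℝ) + β)) ≤
      ENNReal.ofReal M * (ENNReal.ofReal (w (r * ρ)) * ENNReal.ofReal (w (τ - ρ))) := by
    intro τ ρ
    rw [← ENNReal.ofReal_mul (hw _), ← ENNReal.ofReal_mul hM0]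
    apply ENNReal.ofReal_le_ofReal
    have h1 := weight_bound _ _ r τ ρ ha hb hr hr1
    have h2 := mul_le_mul (hK (τ - ρ)) (hL (r * ρ)) (by positivity)
      (mul_nonneg hK0 (hw (τ - ρ)))
    calc _ = (‖fhat (fun s => φ s) (τ - ρ)‖ ^ 2 * ‖fhat (fun s => ψ s) (r * ρ)‖ ^ 2) *
              (|τ| ^ (2 * H - 1) * |ρ| ^ (3 - (N : ℝ) + β)) := by ring
      _ ≤ _ := mul_le_mul_of_nonneg_left h1 (by positivity)
      _ = r ^ (-(2 * H - 1 + (3 - N + β))) * _ := by rw [mul_left_comm]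
      _ ≤ r ^ (-(2 * H - 1 + (3 - N + β))) *
          (K * w (τ - ρ) * (L * w (r * ρ))) := by
        refine mul_le_mul_of_nonneg_left ?_ (by positivity)
        refine le_trans (le_of_eq ?_) h2
        ring
      _ = _ := by rw [hM]; ring
  have hscale : ∫⁻ ρ, ENNReal.ofReal (w (r * ρ)) = ENNReal.ofReal (r⁻¹ * J) := by
    have h := lintegral_map (μ := volume) (f := fun x => ENNReal.ofReal (w x))
      (g := fun x => r * x) (by fun_prop) (by fun_prop)
    have h' := Real.map_volume_mul_left hr.ne'
    rw [← h, h', lintegral_smul_measure, hJI, abs_of_pos (inv_pos.2 hr), smul_eq_mul,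
      ENNReal.ofReal_mul (inv_pos.2 hr).le]
  calc _ ≤ ∫⁻ τ : ℝ, ∫⁻ ρ : ℝ, ENNReal.ofReal M *
        (ENNReal.ofReal (w (r * ρ)) * ENNReal.ofReal (w (τ - ρ))) :=
        lintegral_mono fun τ => lintegral_mono fun ρ => hpt τ ρ
    _ = ∫⁻ ρ : ℝ, ∫⁻ τ : ℝ, ENNReal.ofReal M *
        (ENNReal.ofReal (w (r * ρ)) * ENNReal.ofReal (w (τ - ρ))) := by
        apply lintegral_lintegral_swap
        apply Measurable.aemeasurable
        unfold Function.uncurry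
        fun_prop
    _ = ∫⁻ ρ : ℝ, ENNReal.ofReal M * (ENNReal.ofReal (w (r * ρ)) * ENNReal.ofReal J) := by
        congr 1
        ext ρ
        rw [lintegral_const_mul _ (by fun_prop), lintegral_const_mul _ (by fun_prop),
          lintegral_sub_right_eq_self (fun x => ENNReal.ofReal (w x)) ρ, hJI]
    _ = ENNReal.ofReal (M * (r⁻¹ * J * J)) := by
        rw [lintegral_const_mul _ (by fun_prop), lintegral_mul_const _ (by fun_prop), hscale,
          ← ENNReal.ofReal_mul (by positivity), ← ENNReal.ofReal_mul hM0]
    _ ≤ _ := by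
        apply ENNReal.ofReal_le_ofReal
        apply le_of_eq
        have : r ^ (-(2 * H + 3 - N + β)) = r ^ (-(2 * H - 1 + (3 - N + β))) * r⁻¹ := by
          rw [← Real.rpow_neg_one r, ← Real.rpow_add hr]
          congr 1
          ring
        rw [this, hM]
        ring
end
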